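/- arXiv:2402.13786 — 11 statements merged into one kernel-verified Lean document; each statement's English description precedes it below -/
import Mathlib

section
/- Let D be a digraph of order n ≥ 3k, where k is a positive integer. If δ⁰(D) ≥ ⌈(n + k)/2⌉, then D is unpaired many-to-many k-coverable. -/
/-- A directed path in the digraph with arc relation `A`: a nonempty list of
pairwise distinct vertices, with consecutive vertices joined by arcs,
starting at `s` and ending at `t`. -/
def IsDipath {V : Type*} (A : V → V → Prop) (p : List V) (s t : V) : Prop :=
  p ≠ [] ∧ p.Chain' A ∧ p.Nodup ∧ p.head? = some s ∧ p.getLast? = some t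

/-- The out-degree of a vertex `v` in the digraph with arc relation `A`. -/
noncomputable def outDeg {V : Type*} (A : V → V → Prop) (v : V) : ℕ :=
  Nat.card {w : V // A v w}

/-- The in-degree of a vertex `v` in the digraph with arc relation `A`. -/
noncomputable def inDeg {V : Type*} (A : V → V → Prop) (v : V) : ℕ :=
  Nat.card {w : V // A w v}

/-- The digraph with arc relation `A` is unpaired many-to-many `k`-coverable:
for every disjoint source set `S = {s 0, …, s (k-1)}` and sink set
`T = {t 0, …, t (k-1)}` there are `k` pairwise vertex-disjoint directed paths
covering all vertices, with path `i` going from `s i` to `t (σ i)` for some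
permutation `σ`. -/
def UnpairedMtmCoverable {V : Type*} (A : V → V → Prop) (k : ℕ) : Prop :=
  ∀ s t : Fin k → V, Function.Injective s → Function.Injective t →
    (∀ i j, s i ≠ t j) →
    ∃ (σ : Equiv.Perm (Fin k)) (P : Fin k → List V),
      (∀ i, IsDipath A (P i) (s i) (t (σ i))) ∧
      (∀ i j, i ≠ j → ∀ v, v ∈ P i → v ∉ P j) ∧
      (∀ v : V, ∃ i, v ∈ P i)

open scoped Classical in
/-- A family of duplicate-free lists over a finite type has a member of maximal length. -/
theorem exists_longest_nodup {W : Type*} [Fintype W] (P : List W → Prop)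
    (hP : ∃ c, P c) (hnd : ∀ c, P c → c.Nodup) :
    ∃ c, P c ∧ ∀ d, P d → d.length ≤ c.length := by
  obtain ⟨c₀, h₀⟩ := hP
  have hb : ∀ c, P c → c.length ≤ Fintype.card W := fun c hc => (hnd c hc).length_le_card
  obtain ⟨c, hc, hlen⟩ := Nat.findGreatest_spec
    (P := fun n => ∃ c, P c ∧ c.length = n) (hb c₀ h₀) ⟨c₀, h₀, rfl⟩
  refine ⟨c, hc, fun d hd => ?_⟩
  rw [hlen]
  exact Nat.le_findGreatest (hb d hd) ⟨d, hd, rfl⟩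

/-- A directed cycle, written as the duplicate-free list of its vertices in cyclic order. -/
def IsDicycle {W : Type*} (B : W → W → Prop) (c : List W) : Prop :=
  c.Nodup ∧ (c ++ c).IsChain B

theorem IsDicycle.exists_rotate {W : Type*} {B : W → W → Prop} {c : List W}
    (h : IsDicycle B c) {y : W} (hy : y ∈ c) :
    ∃ d, IsDicycle B (y :: d) ∧ (y :: d).Perm c := by
  obtain ⟨a, b, rfl⟩ := List.append_of_mem hy
  have hp : (y :: (b ++ a)).Perm (a ++ y :: b) := by
    simpa using List.perm_append_comm (l₁ := y :: b) (l₂ := a)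
  refine ⟨b ++ a, ⟨hp.nodup_iff.2 h.1, ?_⟩, hp⟩
  have h2 := h.2
  rw [List.append_assoc, List.isChain_append, List.isChain_append, List.isChain_append] at h2
  rw [← List.cons_append, List.append_assoc, List.isChain_append, List.isChain_append,
    List.isChain_append]
  cases a <;> grind only [List.head?_append, List.head?_cons, List.head?_nil, Option.some_or,
    Option.none_or, Option.mem_some, = Option.mem_def, List.cons_append, List.nil_append,
    List.append_nil, List.IsChain.nil, List.getLast?_nil]

theorem IsDicycle.splice {W : Type*} {B : W → W → Prop} {u mid v p : List W}
    (h : IsDicycle B (u ++ (mid ++ v))) (hu : u ≠ []) (hp : p.Nodup) (hpc : p.IsChain B)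
    (hp0 : p ≠ []) (hdis : ∀ x ∈ p, x ∉ u ∧ x ∉ v)
    (h1 : B (u.getLast hu) (p.head hp0)) (h2 : ∀ y ∈ (v ++ u).head?, B (p.getLast hp0) y) :
    IsDicycle B (u ++ (p ++ v)) := by
  obtain ⟨hn, hc⟩ := h
  refine ⟨?_, ?_⟩
  · simp only [List.nodup_append, List.mem_append] at hn ⊢
    grind
  · have e1 : ∀ x ∈ u.getLast?, x = u.getLast hu := by
      intro x hx; rw [List.getLast?_eq_some_getLast hu] at hx; simpa using hx.symm
    have e2 : ∀ x ∈ p.getLast?, x = p.getLast hp0 := by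
      intro x hx; rw [List.getLast?_eq_some_getLast hp0] at hx; simpa using hx.symm
    have e3 : ∀ x ∈ p.head?, x = p.head hp0 := by
      intro x hx; rw [List.head?_eq_some_head hp0] at hx; simpa using hx.symm
    have e4 : ∀ w, (p ++ w).head? = p.head? := by
      intro w; rw [List.head?_append, List.head?_eq_some_head hp0]; rfl
    have e5 : ∀ w w', (u ++ w).head? = (u ++ w').head? := by
      intro w w'; rw [List.head?_append, List.head?_append, List.head?_eq_some_head hu]; rfl
    have e6 : ∀ w, (v ++ (u ++ w)).head? = (v ++ u).head? := by
      intro w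
      rw [List.head?_append, List.head?_append, List.head?_append, List.head?_eq_some_head hu]; rfl
    simp only [List.append_assoc] at hc ⊢
    have hcu := (List.isChain_append.1 hc).1
    rw [← List.append_assoc, ← List.append_assoc, List.append_assoc, List.isChain_append] at hc
    have hcv := List.isChain_append.1 hc.2.1
    have hpv : (p ++ v).IsChain B := by
      rw [List.isChain_append]
      refine ⟨hpc, hcv.1, fun x hx y hy => ?_⟩
      rw [e2 x hx]; apply h2; rw [List.head?_append]; rw [Option.mem_def.1 hy]; rfl
    have hupv : (u ++ (p ++ v)).IsChain B := by
      rw [List.isChain_append]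
      refine ⟨hcu, hpv, fun x hx y hy => ?_⟩
      rw [e4] at hy
      rw [e1 x hx, e3 y hy]; exact h1
    have hvu : (v ++ (u ++ (p ++ v))).IsChain B := by
      rw [List.isChain_append]
      refine ⟨hcv.1, hupv, fun x hx y hy => hcv.2.2 x hx y ?_⟩
      rw [e5 _ (p ++ v)]; exact hy
    rw [List.isChain_append, List.isChain_append]
    refine ⟨hcu, ⟨hpc, hvu, fun x hx y hy => ?_⟩, fun x hx y hy => ?_⟩
    · rw [e2 x hx]; apply h2; rw [← e6]; exact hy
    · rw [e4] at hy
      rw [e1 x hx, e3 y hy]; exact h1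

theorem exists_dicycle_of_card_le {W : Type*} [Fintype W] [Nonempty W] (B : W → W → Prop)
    [DecidableRel B] (hirr : ∀ x, ¬ B x x)
    (ho : ∀ x, Fintype.card W ≤ 2 * (Finset.univ.filter fun y => B x y).card) :
    ∃ c, IsDicycle B c ∧ Fintype.card W + 2 ≤ 2 * c.length := by
  classical
  obtain ⟨p, ⟨hnd, hch⟩, hmax⟩ := exists_longest_nodup
    (fun p : List W => p.Nodup ∧ p.IsChain B) ⟨[], by simp⟩ (fun c h => h.1)
  have hne : p ≠ [] := by
    rintro rfl
    have := hmax [Classical.arbitrary W] (by simp)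
    simp at this
  set x := p.getLast hne with hx
  have hxp : x ∈ p := List.getLast_mem hne
  have hmem : ∀ y, B x y → y ∈ p := by
    intro y hy
    by_contra hyp
    have := hmax (p ++ [y]) ⟨by simp [List.nodup_append, hnd]; grind, by
      rw [List.isChain_append]
      refine ⟨hch, by simp, ?_⟩
      intro u hu v hv
      rw [List.getLast?_eq_some_getLast hne] at hu
      simp at hu hv
      subst hu hv
      exact hy⟩
    simp at this
  obtain ⟨b, hb⟩ : ∃ b, b = p.dropWhile (fun y => ¬ B x y) := ⟨_, rfl⟩
  have hab : p.takeWhile (fun y => ¬ B x y) ++ b = p := by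
    rw [hb]; exact List.takeWhile_append_dropWhile
  have hta : ∀ y ∈ p.takeWhile (fun y => ¬ B x y), ¬ B x y := fun y hy => by
    simpa using List.mem_takeWhile_imp hy
  generalize p.takeWhile (fun y => ¬ B x y) = a at hab hta
  have hyb : ∀ y, B x y → y ∈ b := by
    intro y hy
    have := hmem y hy
    rw [← hab, List.mem_append] at this
    exact this.resolve_left fun h => hta y h hy
  obtain ⟨z, hz⟩ : ∃ z, B x z := by
    by_contra! hcon
    have h1 := ho x
    have h2 : 0 < Fintype.card W := Fintype.card_pos
    simp [hcon] at h1
  have hbne : b ≠ [] := List.ne_nil_of_mem (hyb z hz)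
  have hxb : b.getLast hbne = x := by
    rw [hx]; simp only [← hab]; rw [List.getLast_append_of_ne_nil]
  have hhead : B x (b.head hbne) := by
    have := List.head_dropWhile_not (fun y => decide (¬ B x y)) (l := p) (by rw [← hb]; exact hbne)
    simp only [← hb] at this
    simpa using this
  have hbnd : b.Nodup := by
    rw [← hab] at hnd; exact (List.nodup_append.1 hnd).2.1
  have hbch : b.IsChain B := by
    rw [← hab] at hch; exact (List.isChain_append.1 hch).2.1
  refine ⟨b, ⟨hbnd, ?_⟩, ?_⟩
  · rw [List.isChain_append]
    refine ⟨hbch, hbch, fun u hu v hv => ?_⟩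
    rw [List.getLast?_eq_some_getLast hbne, hxb] at hu
    rw [List.head?_eq_some_head hbne] at hv
    simp at hu hv
    subst hu hv
    exact hhead
  · have hsub : insert x (Finset.univ.filter fun y => B x y) ⊆ b.toFinset := by
      intro y hy
      simp at hy
      rw [List.mem_toFinset]
      rcases hy with rfl | hy
      · rw [← hxb]; exact List.getLast_mem hbne
      · exact hyb y hy
    have h1 := Finset.card_le_card hsub
    rw [Finset.card_insert_of_notMem (by simp [hirr]), List.toFinset_card_of_nodup hbnd] at h1
    have := ho x
    omega

/-- If every element of `J` above an element of `I` is more than `l` above it, also cyclically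
modulo `m`, then `I` and `J` are small. -/
theorem card_add_card_add_le_of_gap {m l : ℕ} {I J : Finset ℕ} (hI : I.Nonempty)
    (hJ : ∀ j ∈ J, j < m) (hl : 1 ≤ l)
    (hgap : ∀ i ∈ I, ∀ j ∈ J, i < j → i + l < j) (hwrap : ∀ i ∈ I, i + l < m) :
    I.card + J.card + l ≤ m + 1 := by
  set M := I.max' hI
  have hM : M ∈ I := I.max'_mem hI
  have hle : ∀ i ∈ I, i ≤ M := fun i hi => I.le_max' i hi
  have h1 : Disjoint (I.image (· + 1)) (Finset.Icc (M + 2) (M + l)) := by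
    rw [Finset.disjoint_left]
    simp only [Finset.mem_image, Finset.mem_Icc]
    rintro _ ⟨i, hi, rfl⟩
    have := hle i hi
    omega
  have h2 : Disjoint (I.image (· + 1) ∪ Finset.Icc (M + 2) (M + l)) J := by
    rw [Finset.disjoint_left]
    simp only [Finset.mem_union, Finset.mem_image, Finset.mem_Icc]
    rintro j (⟨i, hi, rfl⟩ | hj) hjJ
    · have := hgap i hi _ hjJ (by omega)
      omega
    · have := hgap M hM _ hjJ (by omega)
      omega
  have h3 : (I.image (· + 1) ∪ Finset.Icc (M + 2) (M + l)) ∪ J ⊆ Finset.range m := by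
    intro j
    simp only [Finset.mem_union, Finset.mem_image, Finset.mem_Icc, Finset.mem_range]
    have := hwrap M hM
    rintro ((⟨i, hi, rfl⟩ | hj) | hj)
    · have := hwrap i hi
      omega
    · omega
    · exact hJ j hj
  have h4 := Finset.card_le_card h3
  rw [Finset.card_union_of_disjoint h2, Finset.card_union_of_disjoint h1,
    Finset.card_image_of_injective _ (add_left_injective 1), Nat.card_Icc, Finset.card_range] at h4
  omega

theorem exists_indices {W : Type*} [Fintype W] [DecidableEq W] (l : List W) (Q : W → Prop)
    [DecidablePred Q] :
    ∃ I : Finset ℕ, (∀ i ∈ I, ∃ h : i < l.length, Q (l[i])) ∧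
      (Finset.univ.filter fun x => x ∈ l ∧ Q x).card ≤ I.card := by
  classical
  refine ⟨(Finset.range l.length).filter (fun i => ∃ h : i < l.length, Q (l[i])),
    fun i hi => (Finset.mem_filter.1 hi).2, ?_⟩
  refine Finset.card_le_card_of_injOn (fun x => l.idxOf x) ?_ ?_
  · intro x hx
    simp at hx
    have := List.idxOf_lt_length_iff.2 hx.1
    simp [this, hx.2]
  · intro x hx y hy hxy
    simp at hx hy
    exact (List.idxOf_inj hx.1).1 hxy

/-- **Ghouila-Houri's theorem**, in its minimum semi-degree form. -/
theorem exists_hamiltonian_dicycle {W : Type*} [Fintype W] [Nonempty W] (B : W → W → Prop)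
    [DecidableRel B] (hirr : ∀ x, ¬ B x x)
    (ho : ∀ x, Fintype.card W ≤ 2 * (Finset.univ.filter fun y => B x y).card)
    (hi : ∀ x, Fintype.card W ≤ 2 * (Finset.univ.filter fun y => B y x).card) :
    ∃ c, IsDicycle B c ∧ ∀ x, x ∈ c := by
  classical
  obtain ⟨c₀, hc₀, hlen₀⟩ := exists_dicycle_of_card_le B hirr ho
  obtain ⟨c, hc, hmax⟩ := exists_longest_nodup (IsDicycle B) ⟨c₀, hc₀⟩ (fun c h => h.1)
  refine ⟨c, hc, ?_⟩
  by_contra! hcon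
  obtain ⟨z, hz⟩ := hcon
  have hlen : Fintype.card W + 2 ≤ 2 * c.length := by have := hmax c₀ hc₀; omega
  obtain ⟨p, ⟨hpn, hpc, hpd⟩, hpmax⟩ := exists_longest_nodup
    (fun p : List W => p.Nodup ∧ p.IsChain B ∧ ∀ x ∈ p, x ∉ c)
    ⟨[], by simp⟩ (fun c h => h.1)
  have hp0 : p ≠ [] := by
    rintro rfl
    have := hpmax [z] (by simp [hz])
    simp at this
  have hpl : 1 ≤ p.length := List.length_pos_iff.2 hp0
  have hcp : p.length + c.length ≤ Fintype.card W := by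
    have : (p ++ c).Nodup := List.nodup_append.2 ⟨hpn, hc.1, fun x hx y hy h => hpd x hx (h ▸ hy)⟩
    simpa using this.length_le_card
  set a := p.head hp0 with ha
  set b := p.getLast hp0 with hb
  have hbo : ∀ y, B b y → y ∈ c ∨ y ∈ p := by
    intro y hy
    by_contra! hn
    have := hpmax (p ++ [y]) ⟨by simp [List.nodup_append, hpn]; grind, by
      rw [List.isChain_append]
      refine ⟨hpc, by simp, ?_⟩
      intro u hu v hv
      rw [List.getLast?_eq_some_getLast hp0] at hu
      simp at hu hv
      subst hu hv
      exact hy, by simp; grind⟩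
    simp at this
  have hai : ∀ y, B y a → y ∈ c ∨ y ∈ p := by
    intro y hy
    by_contra! hn
    have := hpmax ([y] ++ p) ⟨by simp [hpn, hn], by
      rw [List.isChain_append]
      refine ⟨by simp, hpc, ?_⟩
      intro u hu v hv
      rw [List.head?_eq_some_head hp0] at hv
      simp at hu hv
      subst hu hv
      exact hy, by simp; grind⟩
    simp at this
  have key : ∀ (Q : W → Prop) [DecidablePred Q] (e : W), e ∈ p → ¬ Q e →
      (∀ y, Q y → y ∈ c ∨ y ∈ p) → Fintype.card W ≤ 2 * (Finset.univ.filter Q).card →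
      Fintype.card W + 2 ≤ 2 * (Finset.univ.filter fun y => y ∈ c ∧ Q y).card + 2 * p.length := by
    intro Q _ e hep hQe hQ hcard
    have hsub : Finset.univ.filter Q ⊆
        (Finset.univ.filter fun y => y ∈ c ∧ Q y) ∪ p.toFinset.erase e := by
      intro y hy
      simp at hy
      simp [hy]
      rcases hQ y hy with h | h
      · exact .inl h
      · exact .inr ⟨fun h' => hQe (h' ▸ hy), h⟩
    have h1 := (Finset.card_le_card hsub).trans (Finset.card_union_le _ _)
    rw [Finset.card_erase_of_mem (by simpa using hep), List.toFinset_card_of_nodup hpn] at h1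
    omega
  have hJc := key (fun y => B b y) b (List.getLast_mem hp0) (hirr b) hbo (ho b)
  have hIc := key (fun y => B y a) a (List.head_mem hp0) (hirr a) hai (hi a)
  obtain ⟨y, hy⟩ : (Finset.univ.filter fun y => y ∈ c ∧ B b y).Nonempty := by
    rw [← Finset.card_pos]; omega
  simp at hy
  obtain ⟨d, hd, hdc⟩ := hc.exists_rotate hy.1
  obtain ⟨I, hI, hIcard⟩ := exists_indices (y :: d) (fun y => B y a)
  obtain ⟨J, hJ, hJcard⟩ := exists_indices (y :: d) (fun y => B b y)
  simp only [hdc.mem_iff] at hIcard hJcard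
  rw [← hdc.length_eq] at hmax hlen hcp
  have hins : ∀ i (h : i < (y :: d).length), B (y :: d)[i] a → ∀ j, i < j →
      j ≤ (y :: d).length →
      (∀ h : j < (y :: d).length, B b (y :: d)[j]) → i + p.length < j := by
    intro i hil hBi j hij hjl hBj
    by_contra! hcon
    have hsplit : (y :: d) = (y :: d).take (i + 1) ++
        (((y :: d).drop (i + 1)).take (j - (i + 1)) ++ (y :: d).drop j) := by
      conv_lhs => rw [← List.take_append_drop (i + 1) (y :: d)]
      congr 1
      conv_lhs => rw [← List.take_append_drop (j - (i + 1)) ((y :: d).drop (i + 1))]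
      rw [List.drop_drop]
      congr 2
      omega
    have hd' := hd
    rw [hsplit] at hd'
    have hne : (y :: d).take (i + 1) ≠ [] := by simp
    have hcyc := hd'.splice (p := p) hne hpn hpc hp0
      (fun x hx => ⟨fun h => hpd x hx (hdc.mem_iff.1 (List.mem_of_mem_take h)),
        fun h => hpd x hx (hdc.mem_iff.1 (List.mem_of_mem_drop h))⟩)
      (by
        convert hBi using 1
        simp only [List.getLast_eq_getElem, List.getElem_take, List.length_take,
          Nat.min_eq_left (Nat.succ_le_of_lt hil)]
        rfl)
      (by
        intro w hw
        rcases hjl.lt_or_eq with h | h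
        · have := hBj h
          rw [List.drop_eq_getElem_cons h] at hw
          simp only [List.cons_append, List.head?_cons, Option.mem_some] at hw
          subst hw
          exact this
        · rw [h] at hw
          simp at hw
          subst hw
          exact hy.2)
    have := hmax _ hcyc
    simp at this hjl hil
    omega
  have hfin := card_add_card_add_le_of_gap (m := (y :: d).length) (l := p.length) (I := I) (J := J)
    (by rw [← Finset.card_pos]; omega) (fun j hj => (hJ j hj).1) hpl
    (fun i hi j hj hij => by
      obtain ⟨h1, h2⟩ := hI i hi
      obtain ⟨h3, h4⟩ := hJ j hj
      exact hins i h1 h2 j hij h3.le (fun _ => h4))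
    (fun i hi => by
      obtain ⟨h1, h2⟩ := hI i hi
      exact hins i h1 h2 _ h1 le_rfl (fun h => absurd h (lt_irrefl _)))
  omega

/-- A chain for `A` starting in `S`, ending in `T` and meeting `S` only at its start. -/
def IsSegment {V : Type*} (A : V → V → Prop) (S T : V → Prop) (q : List V) : Prop :=
  ∃ x q', q = x :: q' ∧ S x ∧ (∀ z ∈ q', ¬ S z) ∧ q.IsChain A ∧ ∃ z, T z ∧ q.getLast? = some z

open scoped Classical in
/-- A walk whose vertices are seen as `β w` when entered and as `α w` when left breaks into
segments at the vertices `w` with `α w ≠ β w`. -/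
theorem exists_segments {V W : Type*} {A : V → V → Prop} {B : W → W → Prop} {S T : V → Prop}
    {α β : W → V} (hB : ∀ x y, B x y → A (α x) (β y)) (hβ : ∀ w, ¬ S (β w))
    (hαβ : ∀ w, α w ≠ β w → S (α w) ∧ T (β w)) {y : W} (hy : T (β y)) (l : List W)
    (hl : (l ++ [y]).IsChain B) :
    ∃ (q : List V) (Q : List (List V)),
      q ++ Q.flatten = l.flatMap (fun w => if α w = β w then [α w] else [β w, α w]) ++ [β y] ∧
      q.head? = (l ++ [y]).head?.map β ∧ q.IsChain A ∧ (∀ z ∈ q, ¬ S z) ∧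
      (∃ z, T z ∧ q.getLast? = some z) ∧ ∀ b ∈ Q, IsSegment A S T b := by
  induction l with
  | nil => exact ⟨[β y], [], by simp, by simp, by simp, by simpa using hβ y, ⟨β y, hy, by simp⟩,
      by simp⟩
  | cons a l ih =>
    rw [List.cons_append, List.isChain_cons] at hl
    obtain ⟨q, Q, h1, h2, h3, h4, ⟨z, hz, hzq⟩, h6⟩ := ih hl.2
    have hch : (α a :: q).IsChain A := by
      rw [List.isChain_cons]
      refine ⟨fun v hv => ?_, h3⟩
      rw [h2] at hv
      obtain ⟨w, hw, rfl⟩ := Option.map_eq_some_iff.1 hv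
      exact hB _ _ (hl.1 w hw)
    have hlast : (α a :: q).getLast? = some z := by
      rw [List.getLast?_cons, hzq]; rfl
    by_cases hab : α a = β a
    · refine ⟨α a :: q, Q, by simp [hab, h1], by simp [hab], hch, ?_, ⟨z, hz, hlast⟩, h6⟩
      intro v hv
      rcases List.mem_cons.1 hv with rfl | hv
      · rw [hab]; exact hβ a
      · exact h4 v hv
    · refine ⟨[β a], (α a :: q) :: Q, by simp [hab, h1], by simp, by simp, by simpa using hβ a,
        ⟨β a, (hαβ a hab).2, by simp⟩, ?_⟩
      intro b hb
      rcases List.mem_cons.1 hb with rfl | hb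
      · exact ⟨_, _, rfl, (hαβ a hab).1, h4, hch, z, hz, hlast⟩
      · exact h6 b hb

theorem exists_cover_of_segments {V : Type*} {A : V → V → Prop} {k : ℕ} {s t : Fin k → V}
    (hs : Function.Injective s) (Q : List (List V)) (hnd : Q.flatten.Nodup)
    (hall : ∀ v, v ∈ Q.flatten)
    (hQ : ∀ q ∈ Q, IsSegment A (fun v => ∃ i, s i = v) (fun v => ∃ i, t i = v) q) :
    ∃ (σ : Equiv.Perm (Fin k)) (P : Fin k → List V),
      (∀ i, IsDipath A (P i) (s i) (t (σ i))) ∧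
      (∀ i j, i ≠ j → ∀ v, v ∈ P i → v ∉ P j) ∧
      (∀ v : V, ∃ i, v ∈ P i) := by
  rw [List.nodup_flatten] at hnd
  have huniq : ∀ q ∈ Q, ∀ q' ∈ Q, ∀ v, v ∈ q → v ∈ q' → q = q' := by
    intro q hq q' hq' v hv hv'
    by_contra hne
    have : Std.Symm (List.Disjoint (α := V)) := ⟨fun _ _ h => h.symm⟩
    exact hnd.2.forall hq hq' hne hv hv'
  have hex : ∀ i, ∃ (q : List V) (j : Fin k), q ∈ Q ∧ q.IsChain A ∧ q.head? = some (s i) ∧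
      q.getLast? = some (t j) := by
    intro i
    obtain ⟨q, hq, hiq⟩ := List.mem_flatten.1 (hall (s i))
    obtain ⟨x, q', rfl, -, hq', hch, z, ⟨j, rfl⟩, hz⟩ := hQ q hq
    refine ⟨_, j, hq, hch, ?_, hz⟩
    rcases List.mem_cons.1 hiq with h | h
    · rw [h]; rfl
    · exact absurd ⟨i, rfl⟩ (hq' _ h)
  choose P σ hPQ hPch hPh hPl using hex
  have hPinj : Function.Injective P := by
    intro i j hij
    have := hPh i
    rw [hij, hPh j] at this
    exact (hs (Option.some_injective _ this)).symm
  have hσ : Function.Injective σ := by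
    intro i j hij
    refine hPinj (huniq _ (hPQ i) _ (hPQ j) (t (σ i)) (List.mem_of_getLast? (hPl i)) ?_)
    rw [hij]
    exact List.mem_of_getLast? (hPl j)
  refine ⟨Equiv.ofBijective σ (Finite.injective_iff_bijective.1 hσ), P, ?_, ?_, ?_⟩
  · intro i
    refine ⟨?_, hPch i, hnd.1 _ (hPQ i), hPh i, hPl i⟩
    intro h
    have := hPh i
    simp [h] at this
  · intro i j hij v hv hv'
    exact hij (hPinj (huniq _ (hPQ i) _ (hPQ j) v hv hv'))
  · intro v
    obtain ⟨q, hq, hvq⟩ := List.mem_flatten.1 (hall v)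
    obtain ⟨x, q', rfl, ⟨i, rfl⟩, -⟩ := hQ q hq
    refine ⟨i, ?_⟩
    rw [← huniq _ hq _ (hPQ i) (s i) (by simp) (List.mem_of_mem_head? (hPh i))]
    exact hvq

/-- Let `D` be a digraph of order `n ≥ 3k`, `k ≥ 1`. If `δ⁰(D) ≥ ⌈(n+k)/2⌉`,
then `D` is unpaired many-to-many `k`-coverable. -/
theorem unpaired_mtm_of_min_semi_degree {V : Type*} [Fintype V]
    (A : V → V → Prop) (hirr : Irreflexive A) (k : ℕ) (hk : 1 ≤ k)
    (hn : 3 * k ≤ Fintype.card V)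
    (hdeg : ∀ v : V, (Fintype.card V + k + 1) / 2 ≤ outDeg A v ∧
      (Fintype.card V + k + 1) / 2 ≤ inDeg A v) :
    UnpairedMtmCoverable A k := by
  classical
  intro s t hs ht hst
  let W := {v : V // ∀ j, v ≠ t j}
  let α : W → V := Subtype.val
  have hα : Function.Injective α := Subtype.val_injective
  have hex : ∀ w : W, ∃ v, (∀ i, s i = α w → v = t i) ∧ ((∀ i, s i ≠ α w) → v = α w) := by
    intro w
    by_cases h : ∃ i, s i = α w
    · obtain ⟨i, hi⟩ := h
      exact ⟨t i, fun j hj => by rw [hs (hi.trans hj.symm)], fun h => absurd hi (h i)⟩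
    · exact ⟨α w, fun i hi => absurd ⟨i, hi⟩ h, fun _ => rfl⟩
  choose β hβs hβn using hex
  have hαT : ∀ w j, α w ≠ t j := fun w j => w.2 j
  have hβcase : ∀ w, (∃ i, s i = α w ∧ β w = t i) ∨ ((∀ i, s i ≠ α w) ∧ β w = α w) := by
    intro w
    by_cases h : ∃ i, s i = α w
    · obtain ⟨i, hi⟩ := h
      exact .inl ⟨i, hi, hβs w i hi⟩
    · exact .inr ⟨not_exists.1 h, hβn w (not_exists.1 h)⟩
  have hβS : ∀ w i, s i ≠ β w := by
    intro w i h
    rcases hβcase w with ⟨j, -, hj⟩ | ⟨hn, hj⟩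
    · exact hst i j (h.trans hj)
    · exact hn i (h.trans hj)
  have hβ : Function.Injective β := by
    intro w w' h
    rcases hβcase w with ⟨i, hi, hj⟩ | ⟨-, hj⟩ <;> rcases hβcase w' with ⟨i', hi', hj'⟩ | ⟨-, hj'⟩
    · have := ht (hj.symm.trans (h.trans hj'))
      subst this
      exact hα (hi.symm.trans hi')
    · exact absurd (hj'.symm.trans (h.symm.trans hj)) (hαT w' i)
    · exact absurd (hj.symm.trans (h.trans hj')) (hαT w i')
    · exact hα (hj.symm.trans (h.trans hj'))
  have hαsurj : ∀ v, v ∉ Finset.univ.image t → ∃ w, α w = v := by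
    intro v hv
    exact ⟨⟨v, fun j h => hv (by simp [h])⟩, rfl⟩
  have hβsurj : ∀ v, v ∉ Finset.univ.image s → ∃ w, β w = v := by
    intro v hv
    simp only [Finset.mem_image, Finset.mem_univ, true_and, not_exists] at hv
    by_cases h : ∃ j, t j = v
    · obtain ⟨j, rfl⟩ := h
      exact ⟨⟨s j, hst j⟩, hβs _ j rfl⟩
    · exact ⟨⟨v, fun j hj => h ⟨j, hj.symm⟩⟩, hβn _ hv⟩
  have hScard : (Finset.univ.image s).card = k := by
    rw [Finset.card_image_of_injective _ hs, Finset.card_univ, Fintype.card_fin]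
  have hTcard : (Finset.univ.image t).card = k := by
    rw [Finset.card_image_of_injective _ ht, Finset.card_univ, Fintype.card_fin]
  have hW : Fintype.card W + k = Fintype.card V := by
    have h : Fintype.card W = (Finset.univ.image t)ᶜ.card := by
      rw [Fintype.card_subtype]
      congr 1
      ext v
      simp [eq_comm]
    rw [h, ← Finset.card_compl_add_card (Finset.univ.image t), hTcard]
  have : Nonempty W := Fintype.card_pos_iff.1 (by omega)
  have key : ∀ (γ : W → V) (R : Finset V) (x : W) (e : V) (N : V → Prop), R.card = k →
      (∀ v, v ∉ R → ∃ w, γ w = v) → ¬ N e → e ∈ insert (γ x) R → γ x ∉ R →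
      Nat.card {v // N v} ≤ (Finset.univ.filter fun w => x ≠ w ∧ N (γ w)).card + k := by
    intro γ R x e N hR hsurj hNe he hx
    have hsub : Finset.univ.filter N ⊆
        (Finset.univ.filter fun w => x ≠ w ∧ N (γ w)).image γ ∪ (insert (γ x) R).erase e := by
      intro v hv
      simp only [Finset.mem_filter, Finset.mem_univ, true_and] at hv
      have hve : v ≠ e := fun h => hNe (h ▸ hv)
      simp only [Finset.mem_union, Finset.mem_image, Finset.mem_filter, Finset.mem_univ, true_and,
        Finset.mem_erase, Finset.mem_insert]
      by_cases hvR : v ∈ R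
      · exact .inr ⟨hve, .inr hvR⟩
      · obtain ⟨w, rfl⟩ := hsurj v hvR
        by_cases hxw : x = w
        · exact .inr ⟨hve, .inl (by rw [hxw])⟩
        · exact .inl ⟨w, ⟨hxw, hv⟩, rfl⟩
    have h1 := (Finset.card_le_card hsub).trans
      ((Finset.card_union_le _ _).trans (Nat.add_le_add_right Finset.card_image_le _))
    rw [Finset.card_erase_of_mem he, Finset.card_insert_of_notMem hx, hR] at h1
    rw [Nat.card_eq_fintype_card, Fintype.card_subtype]
    exact h1
  let B : W → W → Prop := fun x y => x ≠ y ∧ A (α x) (β y)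
  obtain ⟨c, hc, hcall⟩ := exists_hamiltonian_dicycle B (fun x h => h.1 rfl)
    (fun x => by
      have h1 := key β (Finset.univ.image s) x (α x) (A (α x)) hScard hβsurj (hirr _) (by
        rcases hβcase x with ⟨i, hi, -⟩ | ⟨-, hi⟩
        · simp [← hi]
        · simp [hi]) (by simpa using hβS x)
      have h2 := (hdeg (α x)).1
      simp only [outDeg] at h2
      change _ ≤ 2 * (Finset.univ.filter fun w => x ≠ w ∧ A (α x) (β w)).card
      omega)
    (fun x => by
      have h1 := key α (Finset.univ.image t) x (β x) (fun v => A v (β x)) hTcard hαsurj (hirr _) (by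
        rcases hβcase x with ⟨i, -, hi⟩ | ⟨-, hi⟩
        · simp [hi]
        · simp [hi]) (by simpa [eq_comm] using hαT x)
      have h2 := (hdeg (β x)).2
      simp only [inDeg] at h2
      simp only [ne_comm (a := x)] at h1
      change _ ≤ 2 * (Finset.univ.filter fun w => w ≠ x ∧ A (α w) (β x)).card
      omega)
  let u : W := ⟨s ⟨0, hk⟩, hst _⟩
  have hu : β u = t ⟨0, hk⟩ := hβs u _ rfl
  have huS : α u = s ⟨0, hk⟩ := rfl
  have huαβ : α u ≠ β u := by rw [hu, huS]; exact hst _ _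
  obtain ⟨l, ⟨hlnd, hlch⟩, hlc⟩ := hc.exists_rotate (hcall u)
  have hl : (u :: (l ++ [u])).IsChain B := by
    rw [show (u :: l) ++ (u :: l) = (u :: (l ++ [u])) ++ l by simp] at hlch
    exact (List.isChain_append.1 hlch).1
  rw [List.isChain_cons] at hl
  obtain ⟨q, Q, h1, h2, h3, h4, ⟨z, hz, hzq⟩, h6⟩ := exists_segments
    (A := A) (S := fun v => ∃ i, s i = v) (T := fun v => ∃ i, t i = v) (α := α) (β := β)
    (fun x y (h : B x y) => h.2) (fun w ⟨i, hi⟩ => hβS w i hi)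
    (fun w hw => by
      rcases hβcase w with ⟨i, hi, hj⟩ | ⟨-, hi⟩
      · exact ⟨⟨i, hi⟩, ⟨i, hj.symm⟩⟩
      · exact absurd hi.symm hw) ⟨_, hu.symm⟩ l hl.2
  set f : W → List V := fun w => if α w = β w then [α w] else [β w, α w] with hf
  have hfm : ∀ w v, v ∈ f w ↔ v = α w ∨ v = β w := by
    intro w v
    simp only [hf]
    split_ifs with h
    · simp [← h]
    · simp [or_comm]
  have hperm : ((α u :: q) :: Q).flatten.Perm ((u :: l).flatMap f) := by
    rw [List.flatten_cons, List.cons_append, h1, List.flatMap_cons]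
    have : f u = [β u, α u] := if_neg huαβ
    rw [this]
    simp only [List.cons_append, List.nil_append]
    refine .trans (.cons _ List.perm_append_comm) ?_
    exact .swap _ _ _
  refine exists_cover_of_segments hs ((α u :: q) :: Q) ?_ ?_ ?_
  · rw [hperm.nodup_iff, List.nodup_flatMap]
    refine ⟨fun w _ => ?_, List.Pairwise.imp (fun {w w'} hne v hv hv' => ?_) hlnd⟩
    · simp only [hf]
      split_ifs with h
      · simp
      · simpa [eq_comm] using h
    · rw [hfm] at hv hv'
      have hcross : ∀ w w', α w = β w' → w = w' := by
        intro w w' h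
        rcases hβcase w' with ⟨i, -, hi⟩ | ⟨-, hi⟩
        · exact absurd (h.trans hi) (hαT w i)
        · exact hα (h.trans hi)
      rcases hv with rfl | rfl <;> rcases hv' with h | h
      · exact hne (hα h)
      · exact hne (hcross _ _ h)
      · exact hne (hcross _ _ h.symm).symm
      · exact hne (hβ h)
  · intro v
    rw [hperm.mem_iff, List.mem_flatMap]
    by_cases hv : v ∈ Finset.univ.image s
    · obtain ⟨i, -, rfl⟩ := Finset.mem_image.1 hv
      exact ⟨⟨s i, hst i⟩, hlc.mem_iff.2 (hcall _), (hfm _ _).2 (.inl rfl)⟩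
    · obtain ⟨w, rfl⟩ := hβsurj v hv
      exact ⟨w, hlc.mem_iff.2 (hcall _), (hfm _ _).2 (.inr rfl)⟩
  · intro b hb
    rcases List.mem_cons.1 hb with rfl | hb
    · refine ⟨_, _, rfl, ⟨_, huS.symm⟩, h4, ?_, z, hz, by rw [List.getLast?_cons, hzq]; rfl⟩
      rw [List.isChain_cons]
      refine ⟨fun v hv => ?_, h3⟩
      rw [h2] at hv
      obtain ⟨w, hw, rfl⟩ := Option.map_eq_some_iff.1 hv
      exact (hl.1 w hw).2
    · exact h6 b hb
end

section
/- For every integer k ≥ 1 and every integer n ≥ 3k + 1, there exists a digraph D on n vertices with minimum semi-degree δ⁰(D) = ⌈(n + k)/2⌉ − 1 which is not unpaired many-to-many k-coverable. -/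
/-- If the vertices outside `C` are independent, a directed walk ending in `C` has at least as many
vertices in `C` as outside, and strictly more if it also starts in `C`. -/
theorem countP_not_add_le_countP {V : Type*} {A : V → V → Prop} (C : V → Prop) [DecidablePred C]
    (hA : ∀ v w, A v w → C v ∨ C w) (a t : V) (p : List V) (hp : (a :: p).IsChain A)
    (ht : (a :: p).getLast? = some t) (hC : C t) :
    (a :: p).countP (fun v => ¬ C v) + (if C a then 1 else 0) ≤ (a :: p).countP (fun v => C v) := by
  induction p generalizing a with
  | nil =>
    have : a = t := by simpa using ht
    subst this
    simp [hC]
  | cons b l ih =>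
    rw [List.isChain_cons_cons] at hp
    have h := ih b hp.2 (by simpa using ht)
    have hab := hA a b hp.1
    rw [List.countP_cons (a := a), List.countP_cons (a := a)]
    by_cases ha : C a <;> by_cases hb : C b <;> simp_all
    omega

/-- If the vertices outside `C` are independent and the digraph is covered by disjoint directed
paths with both ends in `C`, then `C` exceeds its complement by at least the number of paths. -/
theorem card_not_add_card_le_card {V ι : Type*} [Fintype V] [DecidableEq V] [Fintype ι]
    {A : V → V → Prop} (C : V → Prop) [DecidablePred C]
    (hA : ∀ v w, A v w → C v ∨ C w) (s t : ι → V) (P : ι → List V)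
    (hs : ∀ i, C (s i)) (ht : ∀ i, C (t i)) (hP : ∀ i, IsDipath A (P i) (s i) (t i))
    (hdisj : ∀ i j, i ≠ j → ∀ v, v ∈ P i → v ∉ P j) (hcov : ∀ v, ∃ i, v ∈ P i) :
    (Finset.univ.filter fun v => ¬ C v).card + Fintype.card ι ≤
      (Finset.univ.filter fun v => C v).card := by
  have hpath : ∀ i, (P i).countP (fun v => ¬ C v) + 1 ≤ (P i).countP (fun v => C v) := by
    intro i
    obtain ⟨hne, hchain, -, hhead, hlast⟩ := hP i
    cases hp : P i with
    | nil => exact absurd hp hne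
    | cons a l =>
      rw [hp] at hchain hhead hlast
      have has : a = s i := by simpa using hhead
      have h := countP_not_add_le_countP C hA a (t i) l hchain hlast (ht i)
      rwa [if_pos (has ▸ hs i)] at h
  have hcard : ∀ (Q : V → Prop) [DecidablePred Q],
      (Finset.univ.filter Q).card = ∑ i, (P i).countP (fun v => Q v) := by
    intro Q _
    have hU : Finset.univ.filter Q =
        Finset.univ.biUnion fun i => ((P i).filter fun v => Q v).toFinset := by
      ext v
      simp [hcov v]
    rw [hU, Finset.card_biUnion]
    · refine Finset.sum_congr rfl fun i _ => ?_
      rw [List.toFinset_card_of_nodup ((hP i).2.2.1.filter _), List.countP_eq_length_filter]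
    · intro i _ j _ hij
      refine Finset.disjoint_left.2 ?_
      intro v hv hv'
      simp only [List.mem_toFinset, List.mem_filter] at hv hv'
      exact hdisj i j hij v hv.1 hv'.1
  rw [hcard, hcard C]
  calc _ = ∑ i, ((P i).countP (fun v => ¬ C v) + 1) := by
        simp [Finset.sum_add_distrib]
    _ ≤ _ := Finset.sum_le_sum fun i _ => hpath i

/-- For every `k ≥ 1` and `n ≥ 3k + 1`, there is a digraph on `n` vertices
with minimum semi-degree exactly `⌈(n+k)/2⌉ - 1` which is not unpaired
many-to-many `k`-coverable. -/
theorem exists_not_unpaired_mtm_coverable (k n : ℕ) (hk : 1 ≤ k)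
    (hn : 3 * k + 1 ≤ n) :
    ∃ A : Fin n → Fin n → Prop, Irreflexive A ∧
      (∀ v, (n + k + 1) / 2 - 1 ≤ outDeg A v ∧
        (n + k + 1) / 2 - 1 ≤ inDeg A v) ∧
      (∃ v, outDeg A v = (n + k + 1) / 2 - 1 ∨
        inDeg A v = (n + k + 1) / 2 - 1) ∧
      ¬ UnpairedMtmCoverable A k := by
  obtain ⟨d, hd⟩ : ∃ d, d = (n + k + 1) / 2 - 1 := ⟨_, rfl⟩
  rw [← hd]
  have hcardC : (Finset.univ.filter fun v : Fin n => v.1 < d).card = d := by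
    rw [Fin.card_filter_val_lt]
    omega
  let A : Fin n → Fin n → Prop := fun v w => v ≠ w ∧ (v.1 < d ∨ w.1 < d)
  have hsymm : ∀ v, inDeg A v = outDeg A v := by
    intro v
    simp only [inDeg, outDeg, A, ne_comm, or_comm]
  have hout : ∀ v, outDeg A v =
      (Finset.univ.filter fun w : Fin n => v ≠ w ∧ (v.1 < d ∨ w.1 < d)).card := by
    intro v
    simp only [outDeg, A, Nat.card_eq_fintype_card, Fintype.card_subtype]
  have hlow : ∀ v : Fin n, v.1 < d → outDeg A v = n - 1 := by
    intro v hv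
    rw [hout]
    simp [hv, Finset.filter_ne]
  have hhigh : ∀ v : Fin n, ¬ v.1 < d → outDeg A v = d := by
    intro v hv
    rw [hout]
    refine Eq.trans (congrArg Finset.card ?_) hcardC
    ext w
    simp only [Finset.mem_filter, Finset.mem_univ, true_and, hv, false_or]
    exact and_iff_right_of_imp fun hw hvw => hv (hvw ▸ hw)
  have hdeg : ∀ v, d ≤ outDeg A v := by
    intro v
    by_cases hv : v.1 < d
    · rw [hlow v hv]
      omega
    · rw [hhigh v hv]
  refine ⟨A, fun v hv => hv.1 rfl, fun v => ⟨hdeg v, hsymm v ▸ hdeg v⟩,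
    ⟨⟨d, by omega⟩, Or.inl (hhigh _ (by simp))⟩, fun hcover => ?_⟩
  obtain ⟨σ, P, hP, hdisj, hcov⟩ := hcover (fun i => ⟨i, by omega⟩) (fun i => ⟨k + i, by omega⟩)
    (fun i j h => by simpa [Fin.ext_iff] using h) (fun i j h => by simpa [Fin.ext_iff] using h)
    (fun i j h => by simp only [Fin.mk.injEq] at h; omega)
  have h := card_not_add_card_le_card (fun v : Fin n => v.1 < d) (fun v w h => h.2) _ _ P
    (fun i => by dsimp only; omega) (fun i => by dsimp only; omega) hP hdisj hcov
  have htotal := Finset.card_filter_add_card_filter_not (s := Finset.univ)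
    (fun v : Fin n => v.1 < d)
  rw [hcardC, Finset.card_univ, Fintype.card_fin] at htotal
  rw [hcardC, Fintype.card_fin] at h
  omega
end

section
/- Let D be a digraph of order n = 2k, where k is a positive integer. If δ⁰(D) ≥ ⌈(n + k)/2⌉ − 1 = ⌈3k/2⌉ − 1, then D is unpaired many-to-many k-coverable. -/
open Finset in
/-- A bipartite relation on `Fin k` in which every vertex has at least `d` neighbours on the other
side, where `k ≤ 2 * d`, has a perfect matching. -/
theorem exists_perm_of_le_card_filter {k d : ℕ} (hd : k ≤ 2 * d) (r : Fin k → Fin k → Prop)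
    [DecidableRel r] (hl : ∀ i, d ≤ #{j | r i j}) (hr : ∀ j, d ≤ #{i | r i j}) :
    ∃ σ : Equiv.Perm (Fin k), ∀ i, r i (σ i) := by
  have hall : ∀ X : Finset (Fin k), #X ≤ #{j | ∃ i ∈ X, r i j} := by
    intro X
    obtain rfl | ⟨i, hi⟩ := X.eq_empty_or_nonempty
    · simp
    by_cases hX : #X ≤ d
    · refine (hX.trans (hl i)).trans (card_le_card fun j hj ↦ ?_)
      simp only [mem_filter, mem_univ, true_and] at hj ⊢
      exact ⟨i, hi, hj⟩
    · rw [filter_true_of_mem]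
      · exact card_le_card (subset_univ X)
      · intro j _
        have hlt : #(univ : Finset (Fin k)) < #X + #{i | r i j} := by
          have := hr j
          simp only [card_univ, Fintype.card_fin]
          omega
        obtain ⟨a, ha⟩ :=
          inter_nonempty_of_card_lt_card_add_card (subset_univ X) (subset_univ _) hlt
        simp only [mem_inter, mem_filter, mem_univ, true_and] at ha
        exact ⟨a, ha⟩
  obtain ⟨f, hf, hrf⟩ := (Fintype.all_card_le_filter_rel_iff_exists_injective r).1
    fun X ↦ by convert hall X
  exact ⟨Equiv.ofBijective f (Finite.injective_iff_bijective.1 hf), hrf⟩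

open Finset in
/-- If `s` and `t` together enumerate `V` and `p` fails at some value of `s`, then at most `k - 1`
of the elements satisfying `p` are values of `s`. -/
theorem card_subtype_le_card_filter_add {V : Type*} [Fintype V] {k : ℕ} {s t : Fin k → V}
    (hst : ∀ v, (∃ i, s i = v) ∨ ∃ j, t j = v) (p : V → Prop) (i : Fin k) (hi : ¬ p (s i))
    [DecidablePred fun j ↦ p (t j)] :
    Nat.card {v // p v} ≤ #{j | p (t j)} + (k - 1) := by
  classical
  rw [Nat.card_eq_fintype_card, Fintype.card_subtype]
  have hsub : ({v | p v} : Finset V) ⊆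
      image t {j | p (t j)} ∪ image s (univ.erase i) := by
    intro v hv
    simp only [mem_filter, mem_univ, true_and, mem_union, mem_image, mem_erase, and_true] at hv ⊢
    obtain ⟨a, rfl⟩ | ⟨j, rfl⟩ := hst v
    · exact Or.inr ⟨a, fun h ↦ hi (h ▸ hv), rfl⟩
    · exact Or.inl ⟨j, hv, rfl⟩
  calc _ ≤ _ := card_le_card hsub
    _ ≤ _ := card_union_le _ _
    _ ≤ _ := add_le_add card_image_le (card_image_le.trans (by simp))

/-- Let `D` be a digraph of order `n = 2k`, `k ≥ 1`. If
`δ⁰(D) ≥ ⌈3k/2⌉ - 1`, then `D` is unpaired many-to-many `k`-coverable. -/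
theorem unpaired_mtm_of_min_semi_degree_order_two_k {V : Type*} [Fintype V]
    (A : V → V → Prop) (hirr : Irreflexive A) (k : ℕ) (hk : 1 ≤ k)
    (hn : Fintype.card V = 2 * k)
    (hdeg : ∀ v : V, (3 * k + 1) / 2 - 1 ≤ outDeg A v ∧
      (3 * k + 1) / 2 - 1 ≤ inDeg A v) :
    UnpairedMtmCoverable A k := by
  classical
  intro s t hs ht hst
  have hbij : Function.Bijective (Sum.elim s t) :=
    (Fintype.bijective_iff_injective_and_card _).2 ⟨hs.sumElim ht hst, by simp [hn, two_mul]⟩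
  have hcover : ∀ v, (∃ i, s i = v) ∨ ∃ j, t j = v := fun v ↦ by
    simpa using hbij.surjective v
  obtain ⟨σ, hσ⟩ := exists_perm_of_le_card_filter (d := (k + 1) / 2) (by omega)
    (fun i j ↦ A (s i) (t j))
    (fun i ↦ by
      have h := card_subtype_le_card_filter_add hcover (A (s i)) i (hirr (s i))
      have hd := (hdeg (s i)).1
      unfold outDeg at hd
      omega)
    (fun j ↦ by
      have h := card_subtype_le_card_filter_add (fun v ↦ (hcover v).symm)
        (fun w ↦ A w (t j)) j (hirr (t j))
      have hd := (hdeg (t j)).2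
      unfold inDeg at hd
      omega)
  refine ⟨σ, fun i ↦ [s i, t (σ i)], fun i ↦ ?_, fun i j hij v hi hj ↦ ?_, fun v ↦ ?_⟩
  · refine ⟨by simp, List.isChain_pair.2 (hσ i), ?_, rfl, rfl⟩
    simpa using hst i (σ i)
  · simp only [List.mem_cons, List.not_mem_nil, or_false] at hi hj
    rcases hi with rfl | rfl <;> rcases hj with h | h
    · exact hij (hs h)
    · exact hst _ _ h
    · exact hst _ _ h.symm
    · exact hij (σ.injective (ht h))
  · obtain ⟨i, rfl⟩ | ⟨j, rfl⟩ := hcover v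
    · exact ⟨i, by simp⟩
    · exact ⟨σ.symm j, by simp⟩
end

section
/- For every integer m ≥ 2, the complete bipartite digraph K↔_{m,m} is unpaired many-to-many m-coverable. -/
/-- The complete bipartite digraph `K↔_{m,m}`: vertices are `Fin m ⊕ Fin m`,
with both arcs between every pair of vertices on different sides. -/
def completeBipartiteDigraph (m : ℕ) :
    (Fin m ⊕ Fin m) → (Fin m ⊕ Fin m) → Prop :=
  fun x y => x.isLeft ≠ y.isLeft

/-- If `s` and `t` together enumerate the vertices of `Fin m ⊕ Fin m`, then `s` hits the left side
as often as `t` hits the right side. -/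
theorem card_isLeft_eq_card_not_isLeft {m : ℕ} {s t : Fin m → Fin m ⊕ Fin m}
    (hb : Function.Bijective (Sum.elim s t)) :
    Fintype.card {i // (s i).isLeft = true} = Fintype.card {j // ¬ (t j).isLeft = true} := by
  have h : ∑ v, (Sum.elim s t v).isLeft.toNat = ∑ v : Fin m ⊕ Fin m, v.isLeft.toNat :=
    hb.sum_comp fun v => v.isLeft.toNat
  have hcard (f : Fin m → Bool) : Fintype.card {i // f i = true} = ∑ i, (f i).toNat := by
    rw [Fintype.card_subtype, Finset.card_filter]
    exact Finset.sum_congr rfl fun i _ => by cases f i <;> rfl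
  have hle := Fintype.card_subtype_le fun j => (t j).isLeft = true
  rw [Fintype.card_subtype_compl]
  simp only [hcard, Fintype.card_fin] at hle ⊢
  simp only [Fintype.sum_sum_type, Sum.elim_inl, Sum.elim_inr, Sum.isLeft_inl, Sum.isLeft_inr,
    Bool.toNat_true, Bool.toNat_false, Finset.sum_const, Finset.card_univ, Fintype.card_fin,
    smul_eq_mul, mul_one, mul_zero, add_zero] at h
  omega

/-- If `s` and `t` together enumerate the vertices of `Fin m ⊕ Fin m`, then some permutation matches
every `s i` with a `t j` on the opposite side. -/
theorem exists_perm_completeBipartiteDigraph {m : ℕ} {s t : Fin m → Fin m ⊕ Fin m}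
    (hb : Function.Bijective (Sum.elim s t)) :
    ∃ σ : Equiv.Perm (Fin m), ∀ i, completeBipartiteDigraph m (s i) (t (σ i)) := by
  let e := Fintype.equivOfCardEq (card_isLeft_eq_card_not_isLeft hb)
  refine ⟨e.extendSubtype, fun i => ?_⟩
  unfold completeBipartiteDigraph
  by_cases hi : (s i).isLeft = true
  · have := e.extendSubtype_mem i hi
    rw [hi]
    exact fun h => this h.symm
  · have := not_not.mp (e.extendSubtype_not_mem i hi)
    rwa [this]

/-- For every `m ≥ 2`, the complete bipartite digraph `K↔_{m,m}` is unpaired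
many-to-many `m`-coverable. -/
theorem completeBipartiteDigraph_unpaired_mtm_coverable (m : ℕ) (hm : 2 ≤ m) :
    UnpairedMtmCoverable (completeBipartiteDigraph m) m := by
  intro s t hs ht hst
  have hb : Function.Bijective (Sum.elim s t) :=
    Finite.injective_iff_bijective.mp (hs.sumElim ht hst)
  obtain ⟨σ, hσ⟩ := exists_perm_completeBipartiteDigraph hb
  refine ⟨σ, fun i => [s i, t (σ i)], fun i => ?_, fun i j hij v hi hj => ?_, fun v => ?_⟩
  · exact ⟨by simp, List.isChain_pair.mpr (hσ i), by simpa using hst i (σ i), rfl, rfl⟩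
  · simp only [List.mem_cons, List.not_mem_nil, or_false] at hi hj
    rcases hi with rfl | rfl <;> rcases hj with h | h
    · exact hij (hs h)
    · exact hst _ _ h
    · exact hst _ _ h.symm
    · exact hij (σ.injective (ht h))
  · obtain ⟨i | j, rfl⟩ := hb.surjective v
    · exact ⟨i, by simp⟩
    · exact ⟨σ.symm j, by simp⟩
end

section
/- For all integers m ≥ 2 and 1 ≤ k < m, the complete bipartite digraph K↔_{m,m} is not unpaired many-to-many k-coverable. -/
/-- The weight `1` on the left side and `-1` on the right side of a bipartition. -/
def sideWeight {α β : Type*} : α ⊕ β → ℤ :=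
  Sum.elim (fun _ => 1) (fun _ => -1)

/-- Along a directed path between the two sides, the weights telescope to the
half-sum of the weights of the end vertices. -/
theorem two_mul_sum_sideWeight_eq {α β : Type*} (p : List (α ⊕ β)) (s t : α ⊕ β)
    (hc : p.IsChain fun x y => x.isLeft ≠ y.isLeft)
    (hs : p.head? = some s) (ht : p.getLast? = some t) :
    2 * (p.map sideWeight).sum = sideWeight s + sideWeight t := by
  induction p generalizing s with
  | nil => simp at hs
  | cons a l ih =>
    obtain rfl : a = s := by simpa using hs
    cases l with
    | nil =>
      obtain rfl : a = t := by simpa using ht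
      simp [two_mul]
    | cons b l =>
      rw [List.isChain_cons_cons] at hc
      have h := ih b hc.2 rfl (by simpa [List.getLast?_cons_cons] using ht)
      have hab : sideWeight a + sideWeight b = 0 := by
        have := hc.1
        rcases a with a | a <;> rcases b with b | b <;> simp_all [sideWeight]
      rw [List.map_cons, List.sum_cons]
      linarith

/-- In a disjoint dipath cover of the complete bipartite digraph, the end
vertices are equally distributed over the two sides. -/
theorem sum_sideWeight_ends_eq_zero {m k : ℕ} {s t : Fin k → Fin m ⊕ Fin m}
    {P : Fin k → List (Fin m ⊕ Fin m)}
    (hP : ∀ i, IsDipath (completeBipartiteDigraph m) (P i) (s i) (t i))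
    (hdisj : ∀ i j, i ≠ j → ∀ v, v ∈ P i → v ∉ P j)
    (hcover : ∀ v, ∃ i, v ∈ P i) :
    ∑ i, (sideWeight (s i) + sideWeight (t i)) = 0 := by
  have huniv : (Finset.univ : Finset (Fin m ⊕ Fin m)) =
      Finset.univ.biUnion fun i => (P i).toFinset := by
    ext v
    simpa using hcover v
  have htotal : ∑ v : Fin m ⊕ Fin m, sideWeight v = 0 := by
    simp [sideWeight]
  rw [huniv, Finset.sum_biUnion] at htotal
  · calc ∑ i, (sideWeight (s i) + sideWeight (t i))
        = ∑ i, 2 * ∑ v ∈ (P i).toFinset, sideWeight v := by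
          refine Finset.sum_congr rfl fun i _ => ?_
          obtain ⟨-, hc, hn, hs, ht⟩ := hP i
          rw [List.sum_toFinset _ hn, two_mul_sum_sideWeight_eq _ _ _ hc hs ht]
      _ = 0 := by rw [← Finset.mul_sum, htotal, mul_zero]
  · intro i _ j _ hij
    rw [Function.onFun, Finset.disjoint_left]
    intro v hi hj
    exact hdisj i j hij v (by simpa using hi) (by simpa using hj)

/-- For all `m ≥ 2` and `1 ≤ k < m`, the complete bipartite digraph
`K↔_{m,m}` is not unpaired many-to-many `k`-coverable. -/
theorem completeBipartiteDigraph_not_unpaired_mtm_coverable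
    (m k : ℕ) (hm : 2 ≤ m) (hk : 1 ≤ k) (hkm : k < m) :
    ¬ UnpairedMtmCoverable (completeBipartiteDigraph m) k := by
  intro h
  obtain ⟨n, rfl⟩ : ∃ n, k = n + 1 := ⟨k - 1, by omega⟩
  let s : Fin (n + 1) → Fin m ⊕ Fin m := fun i => Sum.inl ⟨i, by omega⟩
  let t : Fin (n + 1) → Fin m ⊕ Fin m :=
    Fin.cons (Sum.inl ⟨n + 1, hkm⟩) fun i => Sum.inr ⟨i, by omega⟩
  have hs : Function.Injective s := by
    intro i j hij
    simpa [s, Fin.ext_iff] using hij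
  have ht : Function.Injective t := by
    refine Fin.cons_injective_iff.2 ⟨by simp, ?_⟩
    intro i j hij
    simpa [Fin.ext_iff] using hij
  have hst : ∀ i j, s i ≠ t j := by
    intro i j
    refine Fin.cases ?_ (fun j => ?_) j
    · simpa [s, t] using i.isLt.ne
    · simp [s, t]
  obtain ⟨σ, P, hP, hdisj, hcover⟩ := h s t hs ht hst
  have hsum := sum_sideWeight_ends_eq_zero (t := fun i => t (σ i)) hP hdisj hcover
  rw [Finset.sum_add_distrib, Equiv.sum_comp σ fun i => sideWeight (t i),
    Fin.sum_univ_succ (fun i => sideWeight (t i))] at hsum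
  simp [s, t, sideWeight] at hsum
  linarith
end

section
/- For every integer k ≥ 2, there exists a digraph D on n = 2k vertices with minimum semi-degree δ⁰(D) = ⌈(n + k)/2⌉ − 2 = ⌈3k/2⌉ − 2 which is not unpaired many-to-many k-coverable. -/
/-- If every vertex is a source or a sink, then each path of a disjoint path cover
is a single arc from its source to its sink. -/
theorem arc_of_disjoint_path_cover {V : Type*} {A : V → V → Prop} {k : ℕ}
    {s t : Fin k → V} (hst : ∀ i j, s i ≠ t j) (hV : ∀ v, (∃ i, v = s i) ∨ ∃ j, v = t j)
    {σ : Equiv.Perm (Fin k)} {P : Fin k → List V}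
    (hP : ∀ i, IsDipath A (P i) (s i) (t (σ i)))
    (hdisj : ∀ i j, i ≠ j → ∀ v, v ∈ P i → v ∉ P j) (i : Fin k) :
    A (s i) (t (σ i)) := by
  have hs : ∀ j, s j ∈ P j := fun j => List.mem_of_head? (hP j).2.2.2.1
  have ht : ∀ j, t (σ j) ∈ P j := fun j => List.mem_of_getLast? (hP j).2.2.2.2
  have hmem : ∀ v ∈ P i, v = s i ∨ v = t (σ i) := by
    intro v hv
    rcases hV v with ⟨j, rfl⟩ | ⟨j, rfl⟩
    · by_cases h : i = j
      · exact Or.inl (h ▸ rfl)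
      · exact absurd (hs j) (hdisj i j h _ hv)
    · by_cases h : i = σ.symm j
      · exact Or.inr (by simp [h])
      · exact absurd (by simpa using ht (σ.symm j)) (hdisj i _ h _ hv)
  obtain ⟨-, hchain, hnodup, hhead, hlast⟩ := hP i
  generalize P i = p at *
  match p with
  | [] => simp at hhead
  | [a] =>
    simp only [List.head?_cons, List.getLast?_singleton, Option.some.injEq] at hhead hlast
    exact absurd (hhead.symm.trans hlast) (hst i (σ i))
  | a :: b :: l =>
    simp only [List.head?_cons, Option.some.injEq] at hhead
    subst hhead
    have hab : A (s i) b := (List.isChain_cons_cons.mp hchain).1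
    rcases hmem b (by simp) with h | h
    · simp [h] at hnodup
    · exact h ▸ hab

theorem Fin.natCard_subtype_val (n : ℕ) (p : ℕ → Prop) [DecidablePred p] :
    Nat.card {w : Fin n // p w} = ((Finset.range n).filter p).card := by
  rw [Nat.card_eq_fintype_card, Fintype.card_subtype, ← Finset.card_map Fin.valEmbedding]
  congr 1
  ext w
  simp only [Finset.mem_map, Finset.mem_filter, Finset.mem_univ, true_and, Finset.mem_range,
    Fin.valEmbedding_apply]
  exact ⟨fun ⟨v, hv, h⟩ => h ▸ ⟨v.2, hv⟩, fun ⟨hw, h⟩ => ⟨⟨w, hw⟩, h, rfl⟩⟩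

theorem le_natCard_of_not_imp {n m x a b : ℕ} {p : ℕ → Prop}
    (h : ∀ w < n, ¬ p w → w = x ∨ (a ≤ w ∧ w < b)) (hm : m + 1 + (b - a) ≤ n) :
    m ≤ Nat.card {w : Fin n // p w} := by
  classical
  rw [Fin.natCard_subtype_val]
  have h₁ := Finset.card_filter_add_card_filter_not (s := Finset.range n) p
  have h₂ : ((Finset.range n).filter fun w => ¬ p w).card ≤ (insert x (Finset.Ico a b)).card := by
    refine Finset.card_le_card fun w hw => ?_
    rw [Finset.mem_filter, Finset.mem_range] at hw
    simpa using h w hw.1 hw.2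
  have h₃ := Finset.card_insert_le x (Finset.Ico a b)
  rw [Finset.card_range] at h₁
  rw [Nat.card_Ico] at h₃
  omega

/-- The vertices below `k` are the sources, the others the sinks. All arcs are present
except those joining one of the first `d + 1` sources to a sink outside the first `d` ones,
or another source to one of the first `d` sinks. -/
def splitArc (k d x y : ℕ) : Prop :=
  x ≠ y ∧ (x < k → k ≤ y → (x ≤ d ↔ y < k + d))

theorem le_natCard_splitArc_left {k d x : ℕ} (hd : 2 * d + 1 ≤ k) :
    k + d - 1 ≤ Nat.card {w : Fin (2 * k) // splitArc k d x w} := by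
  by_cases h : x ≤ d
  · refine le_natCard_of_not_imp (p := splitArc k d x) (x := x) (a := k + d) (b := 2 * k)
      (fun w _ _ => ?_) ?_
    · grind [splitArc]
    · omega
  · refine le_natCard_of_not_imp (p := splitArc k d x) (x := x) (a := k) (b := k + d)
      (fun w _ _ => ?_) ?_
    · grind [splitArc]
    · omega

theorem le_natCard_splitArc_right {k d y : ℕ} (hd : 2 * d + 1 ≤ k) :
    k + d - 1 ≤ Nat.card {w : Fin (2 * k) // splitArc k d w y} := by
  by_cases h : y < k + d
  · refine le_natCard_of_not_imp (p := fun w => splitArc k d w y) (x := y) (a := d + 1) (b := k)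
      (fun w _ _ => ?_) ?_
    · grind [splitArc]
    · omega
  · refine le_natCard_of_not_imp (p := fun w => splitArc k d w y) (x := y) (a := 0) (b := d + 1)
      (fun w _ _ => ?_) ?_
    · grind [splitArc]
    · omega

theorem natCard_splitArc_zero_le {k d : ℕ} :
    Nat.card {w : Fin (2 * k) // splitArc k d 0 w} ≤ k + d - 1 := by
  classical
  rw [Fin.natCard_subtype_val, ← Nat.card_Ico]
  refine Finset.card_le_card fun w hw => ?_
  rw [Finset.mem_filter, Finset.mem_range] at hw
  obtain ⟨hw, h0, h⟩ := hw
  rw [Finset.mem_Ico]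
  grind

theorem not_unpairedMtmCoverable_splitArc {k d : ℕ} (hd : d < k) :
    ¬ UnpairedMtmCoverable (fun x y : Fin (2 * k) => splitArc k d x y) k := by
  intro h
  let s : Fin k → Fin (2 * k) := fun i => ⟨i, by omega⟩
  let t : Fin k → Fin (2 * k) := fun i => ⟨k + i, by omega⟩
  have hst : ∀ i j, s i ≠ t j := fun i j h => by
    simp only [s, t, Fin.mk.injEq] at h
    omega
  obtain ⟨σ, P, hP, hdisj, -⟩ := h s t
    (fun i j h => by simpa [s, Fin.ext_iff] using h)
    (fun i j h => by simpa [t, Fin.ext_iff] using h) hst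
  have harc : ∀ i : Fin k, splitArc k d (s i) (t (σ i)) := by
    refine arc_of_disjoint_path_cover hst (fun v => ?_) hP hdisj
    by_cases hv : (v : ℕ) < k
    · exact Or.inl ⟨⟨v, hv⟩, rfl⟩
    · exact Or.inr ⟨⟨v - k, by omega⟩, Fin.ext (by simp only [t]; omega)⟩
  have hσ : ∀ i : Fin (d + 1), (σ ⟨i, by omega⟩ : ℕ) < d := fun i => by
    have := (harc ⟨i, by omega⟩).2 (by simp only [s]; omega) (by simp only [t]; omega)
    simp only [s, t] at this
    omega
  have hcard := Fintype.card_le_of_injective (fun i : Fin (d + 1) => (⟨_, hσ i⟩ : Fin d))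
    fun i j hij => by
      simpa [← Fin.ext_iff] using hij
  simp at hcard

/-- For every `k ≥ 2`, there is a digraph on `2k` vertices with minimum
semi-degree exactly `⌈3k/2⌉ - 2` which is not unpaired many-to-many
`k`-coverable. -/
theorem exists_not_unpaired_mtm_coverable_order_two_k (k : ℕ) (hk : 2 ≤ k) :
    ∃ A : Fin (2 * k) → Fin (2 * k) → Prop, Irreflexive A ∧
      (∀ v, (3 * k + 1) / 2 - 2 ≤ outDeg A v ∧
        (3 * k + 1) / 2 - 2 ≤ inDeg A v) ∧
      (∃ v, outDeg A v = (3 * k + 1) / 2 - 2 ∨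
        inDeg A v = (3 * k + 1) / 2 - 2) ∧
      ¬ UnpairedMtmCoverable A k := by
  have hd : 2 * ((k - 1) / 2) + 1 ≤ k := by omega
  have hdeg : (3 * k + 1) / 2 - 2 = k + (k - 1) / 2 - 1 := by omega
  rw [hdeg]
  exact ⟨fun x y => splitArc k ((k - 1) / 2) x y, fun x h => h.1 rfl,
    fun v => ⟨le_natCard_splitArc_left hd, le_natCard_splitArc_right hd⟩,
    ⟨⟨0, by omega⟩, Or.inl (le_antisymm natCard_splitArc_zero_le (le_natCard_splitArc_left hd))⟩,
    not_unpairedMtmCoverable_splitArc (by omega)⟩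
end

section
/- Let D be a digraph of order n ≥ 4. If d⁺_D(x) + d⁻_D(y) ≥ n + 2 for every ordered pair of distinct vertices x, y with xy not an arc of D, then D is paired many-to-many 2-coverable. -/
/-- The digraph with arc relation `A` is paired many-to-many `k`-coverable:
for every disjoint source set `S = {s 0, …, s (k-1)}` and sink set
`T = {t 0, …, t (k-1)}` there are `k` pairwise vertex-disjoint directed paths
covering all vertices, with path `i` going from `s i` to `t i`. -/
def PairedMtmCoverable {V : Type*} (A : V → V → Prop) (k : ℕ) : Prop :=
  ∀ s t : Fin k → V, Function.Injective s → Function.Injective t →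
    (∀ i j, s i ≠ t j) →
    ∃ P : Fin k → List V,
      (∀ i, IsDipath A (P i) (s i) (t i)) ∧
      (∀ i j, i ≠ j → ∀ v, v ∈ P i → v ∉ P j) ∧
      (∀ v : V, ∃ i, v ∈ P i)

/-- Every arc from the last element of `l` to the first element of `m` is present
(vacuous if one of the lists is empty). -/
def Linked {V : Type*} (A : V → V → Prop) (l m : List V) : Prop :=
  ∀ x ∈ l.getLast?, ∀ y ∈ m.head?, A x y

/-- The list `l` consists of distinct vertices and is a closed chain for `A`. -/
structure IsCyclicList {V : Type*} (A : V → V → Prop) (l : List V) : Prop where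
  nodup : l.Nodup
  chain : l.IsChain A
  linked : Linked A l l

theorem IsCyclicList.append_comm {V : Type*} {A : V → V → Prop} {l m : List V}
    (h : IsCyclicList A (l ++ m)) : IsCyclicList A (m ++ l) := by
  obtain ⟨hn, hc, hl⟩ := h
  rcases eq_or_ne l [] with rfl | hl0
  · simpa using IsCyclicList.mk hn hc hl
  rcases eq_or_ne m [] with rfl | hm0
  · simpa using IsCyclicList.mk hn hc hl
  rw [List.isChain_append] at hc
  refine ⟨List.nodup_append_comm.1 hn, List.isChain_append.2 ⟨hc.2.1, hc.1, ?_⟩, ?_⟩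
  · intro x hx y hy
    exact hl x (by rw [List.getLast?_append_of_ne_nil _ hm0]; exact hx) y
      (by rw [List.head?_append_of_ne_nil _ hl0]; exact hy)
  · intro x hx y hy
    rw [List.getLast?_append_of_ne_nil _ hl0] at hx
    rw [List.head?_append_of_ne_nil _ hm0] at hy
    exact hc.2.2 x hx y hy

/-- If `p` and `q` together hold at least `l.length + 2` times on `l`, then some element
satisfying `p` is directly followed by an element satisfying `q`. -/
theorem List.exists_consecutive_of_length_add_two_le {α : Type*} (p q : α → Bool) (l : List α)
    (h : l.length + 2 ≤ l.countP p + l.countP q) :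
    ∃ l₁ z w l₂, l = l₁ ++ z :: w :: l₂ ∧ p z ∧ q w := by
  by_contra hne
  have key : ∀ m : List α, (¬ ∃ l₁ z w l₂, m = l₁ ++ z :: w :: l₂ ∧ p z ∧ q w) →
      m.countP p + m.countP q ≤ m.length + (if m.head?.any q then 1 else 0) := by
    intro m
    induction m with
    | nil => simp
    | cons z m ih =>
      intro hm
      have hm' := ih (by
        rintro ⟨l₁, x, w, l₂, rfl, hx, hw⟩
        exact hm ⟨z :: l₁, x, w, l₂, rfl, hx, hw⟩)
      cases m with
      | nil => by_cases hp : p z <;> by_cases hq : q z <;> simp [hp, hq]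
      | cons w m =>
        have hzw : ¬ (p z ∧ q w) := fun hh => hm ⟨[], z, w, m, rfl, hh.1, hh.2⟩
        rw [List.countP_cons (a := z), List.countP_cons (a := z), List.length_cons (a := z)]
        generalize (w :: m).countP p = cp at *
        generalize (w :: m).countP q = cq at *
        generalize (w :: m).length = k at *
        have hm' : cp + cq ≤ k + (if q w then 1 else 0) := hm'
        change _ ≤ _ + (if q z then 1 else 0)
        by_cases hp : p z
        · rw [if_neg fun hw => hzw ⟨hp, hw⟩] at hm'
          rw [if_pos hp]
          omega
        · rw [if_neg hp]
          split_ifs at hm' ⊢ <;> omega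
  have := key l hne
  split_ifs at this <;> omega

theorem List.countP_add_countP_le_length {α : Type*} (p q : α → Bool) (l : List α)
    (h : ∀ x ∈ l, ¬ (p x ∧ q x)) : l.countP p + l.countP q ≤ l.length := by
  induction l with
  | nil => simp
  | cons z l ih =>
    have := ih fun x hx => h x (List.mem_cons_of_mem _ hx)
    have hz := h z List.mem_cons_self
    simp only [List.countP_cons, List.length_cons]
    split_ifs <;> simp_all <;> omega

theorem Relation.ReflTransGen.exists_nodup_isChain {α : Type*} {r : α → α → Prop} {a b : α}
    (h : Relation.ReflTransGen r a b) :
    ∃ l : List α, l.Nodup ∧ l.IsChain r ∧ l.head? = some a ∧ l.getLast? = some b := by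
  induction h using Relation.ReflTransGen.head_induction_on with
  | refl => exact ⟨[b], by simp⟩
  | @head a c hac _ ih =>
    obtain ⟨l, hn, hc, hh, hl⟩ := ih
    by_cases ha : a ∈ l
    · obtain ⟨l₁, l₂, rfl⟩ := List.append_of_mem ha
      refine ⟨a :: l₂, (List.nodup_append.1 hn).2.1, (List.isChain_append.1 hc).2.1, rfl, ?_⟩
      rwa [List.getLast?_append_of_ne_nil _ (by simp)] at hl
    · refine ⟨a :: l, List.nodup_cons.2 ⟨ha, hn⟩, ?_, rfl, ?_⟩
      · cases l with
        | nil => simp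
        | cons x l =>
          obtain rfl : x = c := by simpa using hh
          exact List.isChain_cons_cons.2 ⟨hac, hc⟩
      · cases l with
        | nil => simp at hh
        | cons x l => simpa using hl

/-- Reachability using only vertices outside `C`. -/
def ReachOff {V : Type*} (A : V → V → Prop) (C : List V) : V → V → Prop :=
  Relation.ReflTransGen fun a b => a ∉ C ∧ b ∉ C ∧ A a b

/-- The cyclic list `Q ++ G` is an arrangement of `C`, and there is a detour outside `C`
from the last element of `Q` to its first one, starting at `a` and bypassing `G`. -/
structure IsBypass {V : Type*} (A : V → V → Prop) (C Q G : List V) (a b : V) : Prop where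
  cyclic : IsCyclicList A (Q ++ G)
  perm : (Q ++ G).Perm C
  ne_nil : Q ≠ []
  left_notMem : a ∉ C
  right_notMem : b ∉ C
  reach : ReachOff A C a b
  enter : ∀ x ∈ Q.getLast?, A x a
  leave : ∀ y ∈ Q.head?, A b y

theorem IsBypass.exists_path {V : Type*} {A : V → V → Prop} {C Q G : List V} {a b : V}
    (h : IsBypass A C Q G a b) :
    ∃ P : List V, P ≠ [] ∧ P.Nodup ∧ P.IsChain A ∧ P.head? = some a ∧ P.getLast? = some b ∧
      ∀ v ∈ P, v ∉ C := by
  obtain ⟨P, hn, hc, hh, hl⟩ := h.reach.exists_nodup_isChain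
  refine ⟨P, by rintro rfl; simp at hh, hn, hc.imp fun _ _ hab => hab.2.2, hh, hl, ?_⟩
  cases P with
  | nil => simp
  | cons x P =>
    obtain rfl : x = a := by simpa using hh
    intro v hv
    rcases List.mem_cons.1 hv with rfl | hv
    · exact h.left_notMem
    · obtain ⟨l₁, l₂, rfl⟩ := List.append_of_mem hv
      clear hh hl hn hv
      rw [← List.cons_append, List.isChain_append] at hc
      obtain ⟨y, hy⟩ : ∃ y, y ∈ (x :: l₁).getLast? := by
        exact ⟨_, List.getLast?_eq_getLast_of_ne_nil (by simp)⟩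
      exact (hc.2.2 y hy v (by simp)).2.1

theorem IsBypass.enter_at {V : Type*} {A : V → V → Prop} {C Q G₁ G₂ : List V} {a b z w : V}
    (h : IsBypass A C Q (G₁ ++ z :: G₂) a b) (hw : w ∉ C) (hzw : A z w)
    (hwb : ReachOff A C w b) : IsBypass A C (Q ++ G₁ ++ [z]) G₂ w b where
  cyclic := by simpa using h.cyclic
  perm := by simpa using h.perm
  ne_nil := by simp
  left_notMem := hw
  right_notMem := h.right_notMem
  reach := hwb
  enter := by simpa using hzw
  leave := by
    rw [List.append_assoc, List.head?_append_of_ne_nil _ h.ne_nil]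
    exact h.leave

theorem IsBypass.leave_at {V : Type*} {A : V → V → Prop} {C Q G₁ G₂ : List V} {a b z w : V}
    (h : IsBypass A C Q (G₁ ++ z :: G₂) a b) (hw : w ∉ C) (hwz : A w z)
    (haw : ReachOff A C a w) : IsBypass A C (z :: G₂ ++ Q) G₁ a w where
  cyclic := by
    have := IsCyclicList.append_comm (l := Q ++ G₁) (m := z :: G₂) (by simpa using h.cyclic)
    simpa using this
  perm := by
    refine .trans ?_ h.perm
    have := List.perm_append_comm (l₁ := z :: G₂) (l₂ := Q ++ G₁)
    simpa using this
  ne_nil := by simp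
  left_notMem := h.left_notMem
  right_notMem := hw
  reach := haw
  enter := by
    rw [List.getLast?_append_of_ne_nil _ h.ne_nil]
    exact h.enter
  leave := by simpa using hwz

theorem exists_isBypass {V : Type*} {A : V → V → Prop} {C : List V} (hC : IsCyclicList A C)
    (htwo : ∀ x y, ∃ w, A x w ∧ A w y) (hne : C ≠ []) {r : V} (hr : r ∉ C) :
    ∃ Q G a b, IsBypass A C Q G a b := by
  obtain ⟨c, hc⟩ := List.exists_mem_of_ne_nil C hne
  obtain ⟨x, hx, a, ha, hxa, har⟩ : ∃ x ∈ C, ∃ a, a ∉ C ∧ A x a ∧ ReachOff A C a r := by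
    obtain ⟨w, hcw, hwr⟩ := htwo c r
    by_cases hw : w ∈ C
    · exact ⟨w, hw, r, hr, hwr, .refl⟩
    · exact ⟨c, hc, w, hw, hcw, .single ⟨hw, hr, hwr⟩⟩
  obtain ⟨y, hy, b, hb, hby, hrb⟩ : ∃ y ∈ C, ∃ b, b ∉ C ∧ A b y ∧ ReachOff A C r b := by
    obtain ⟨w, hrw, hwc⟩ := htwo r c
    by_cases hw : w ∈ C
    · exact ⟨w, hw, r, hr, hrw, .refl⟩
    · exact ⟨c, hc, w, hw, hwc, .single ⟨hr, hw, hrw⟩⟩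
  obtain ⟨l₁, l₂, rfl⟩ := List.append_of_mem hy
  have hperm : (y :: l₂ ++ l₁).Perm (l₁ ++ y :: l₂) := List.perm_append_comm
  obtain ⟨m₁, m₂, hm⟩ := List.append_of_mem (hperm.mem_iff.2 hx)
  refine ⟨m₁ ++ [x], m₂, a, b, ?_, ?_, by simp, ha, hb, har.trans hrb, by simpa using hxa, ?_⟩
  · simpa [hm] using hC.append_comm
  · simpa [hm] using hperm
  · have : (m₁ ++ [x]).head? = some y := by
      rw [List.cons_append] at hm
      cases m₁ <;> simp_all
    simpa [this] using hby

section Woodall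

variable {V : Type*} {A : V → V → Prop} {C Q G : List V} {a b : V}

theorem IsBypass.gap_ne_nil (h : IsBypass A C Q G a b)
    (hmax : ∀ l, IsCyclicList A l → l.length ≤ C.length) : G ≠ [] := by
  rintro rfl
  obtain ⟨P, hP0, hPn, hPc, hPa, hPb, hPC⟩ := h.exists_path
  have hc := h.cyclic
  have hp := h.perm
  rw [List.append_nil] at hc hp
  have := hmax (Q ++ P) ⟨?_, ?_, ?_⟩
  · rw [List.length_append, hp.length_eq] at this
    have := List.length_pos_of_ne_nil hP0
    omega
  · refine List.nodup_append'.2 ⟨hc.nodup, hPn, fun v hv hv' => hPC v hv' (hp.mem_iff.1 hv)⟩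
  · refine List.isChain_append.2 ⟨hc.chain, hPc, ?_⟩
    simpa [hPa] using h.enter
  · intro x hx y hy
    rw [List.getLast?_append_of_ne_nil _ hP0] at hx
    rw [List.head?_append_of_ne_nil _ h.ne_nil] at hy
    obtain rfl : b = x := by simpa [hPb] using hx
    exact h.leave y hy

theorem IsBypass.no_insert_vertex (h : IsBypass A C Q G a b)
    (hmax : ∀ l, IsCyclicList A l → l.length ≤ C.length) {l₁ l₂ : List V} {z w : V}
    (hQ : Q = l₁ ++ z :: w :: l₂) (hz : A z a) (hw : A a w) : False := by
  subst hQ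
  have hc := h.cyclic
  have haC := fun hh => h.left_notMem (h.perm.mem_iff.1 hh)
  have := hmax (a :: (w :: l₂ ++ G ++ (l₁ ++ [z]))) ?_
  · have := h.perm.length_eq
    simp at *
    omega
  · have hrot := IsCyclicList.append_comm (l := l₁ ++ [z]) (m := w :: l₂ ++ G) (by simpa using hc)
    refine ⟨List.nodup_cons.2 ⟨by simp at haC ⊢; tauto, hrot.nodup⟩, ?_, ?_⟩
    · exact List.isChain_cons_cons.2 ⟨hw, by simpa using hrot.chain⟩
    · intro x hx y hy
      simp at hy
      subst hy
      rw [← List.cons_append, ← List.append_assoc, List.getLast?_append_of_ne_nil _ (by simp)] at hx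
      simp at hx
      exact hx ▸ hz

theorem IsBypass.no_insert_gap (h : IsBypass A C Q G a b)
    (hmax : ∀ l, IsCyclicList A l → l.length ≤ C.length) {l₁ l₂ : List V} {z w : V}
    (hQ : Q = l₁ ++ z :: w :: l₂) (hG0 : G ≠ []) (hz : ∀ g ∈ G.head?, A z g)
    (hw : ∀ g ∈ G.getLast?, A g w) : False := by
  subst hQ
  obtain ⟨P, hP0, hPn, hPc, hPa, hPb, hPC⟩ := h.exists_path
  have hc := h.cyclic
  have hch : (l₁ ++ [z]).IsChain A ∧ (w :: l₂).IsChain A ∧ G.IsChain A := by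
    have := hc.chain
    rw [List.isChain_append] at this
    have h2 := this.1
    rw [show l₁ ++ z :: w :: l₂ = (l₁ ++ [z]) ++ w :: l₂ by simp, List.isChain_append] at h2
    exact ⟨h2.1, h2.2.1, this.2.1⟩
  have hperm : (((l₁ ++ [z]) ++ G) ++ (w :: l₂)).Perm ((l₁ ++ z :: w :: l₂) ++ G) := by
    have : (G ++ w :: l₂).Perm (w :: l₂ ++ G) := List.perm_append_comm
    simpa using (this.append_left (l₁ ++ [z]))
  have := hmax ((((l₁ ++ [z]) ++ G) ++ (w :: l₂)) ++ P) ⟨?_, ?_, ?_⟩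
  · rw [List.length_append, (hperm.trans h.perm).length_eq] at this
    have := List.length_pos_of_ne_nil hP0
    omega
  · exact List.nodup_append'.2 ⟨hperm.nodup_iff.2 hc.nodup, hPn,
      fun v hv hv' => hPC v hv' ((hperm.trans h.perm).mem_iff.1 hv)⟩
  · refine List.isChain_append.2 ⟨List.isChain_append.2
      ⟨List.isChain_append.2 ⟨hch.1, hch.2.2, by simpa using hz⟩, hch.2.1, ?_⟩, hPc, ?_⟩
    · rw [List.getLast?_append_of_ne_nil _ hG0]
      simpa using hw
    · have := h.enter
      rw [List.getLast?_append_of_ne_nil _ (by simp)] at this ⊢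
      simpa [hPa] using this
  · intro x hx y hy
    rw [List.getLast?_append_of_ne_nil _ hP0] at hx
    obtain rfl : b = x := by simpa [hPb] using hx
    refine h.leave y ?_
    cases l₁ <;> simpa using hy

end Woodall

/-- **Woodall's theorem**, for a reflexive relation: if the degrees (counting loops) satisfy
`d⁺(x) + d⁻(y) ≥ n + 2` whenever `xy` is not an arc, there is a Hamiltonian cycle. -/
theorem exists_isCyclicList_of_ore {V : Type*} [Fintype V] (A : V → V → Prop) [DecidableRel A]
    (hrefl : ∀ x, A x x)
    (hdeg : ∀ x y, ¬ A x y → Fintype.card V + 2 ≤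
      (Finset.univ.filter fun w => A x w).card + (Finset.univ.filter fun w => A w y).card) :
    ∃ C : List V, IsCyclicList A C ∧ ∀ v, v ∈ C := by
  classical
  have htwo : ∀ x y, ∃ w, A x w ∧ A w y := by
    intro x y
    by_cases hxy : A x y
    · exact ⟨x, hrefl x, hxy⟩
    by_contra! hno
    have hd : Disjoint (Finset.univ.filter fun w => A x w) (Finset.univ.filter fun w => A w y) :=
      Finset.disjoint_filter.2 fun w _ => hno w
    have := hdeg x y hxy
    rw [← Finset.card_union_of_disjoint hd] at this
    have := Finset.card_le_univ
      ((Finset.univ.filter fun w => A x w) ∪ (Finset.univ.filter fun w => A w y))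
    omega
  obtain ⟨C, hC, hmax⟩ : ∃ C, IsCyclicList A C ∧ ∀ l, IsCyclicList A l → l.length ≤ C.length := by
    have hbdd : BddAbove {k | ∃ l, IsCyclicList A l ∧ l.length = k} :=
      ⟨Fintype.card V, by rintro _ ⟨l, hl, rfl⟩; exact hl.nodup.length_le_card⟩
    obtain ⟨C, hC, hk⟩ := Nat.sSup_mem
      (s := {k | ∃ l, IsCyclicList A l ∧ l.length = k})
      ⟨0, [], ⟨by simp, by simp, by simp [Linked]⟩, rfl⟩ hbdd
    exact ⟨C, hC, fun l hl => hk ▸ le_csSup hbdd ⟨l, hl, rfl⟩⟩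
  refine ⟨C, hC, fun r => ?_⟩
  by_contra hr
  have hne : C ≠ [] := by
    rintro rfl
    have := hmax [r] ⟨by simp, by simp, by simpa [Linked] using hrefl r⟩
    simp at this
  have hex : ∃ k Q G a b, IsBypass A C Q G a b ∧ G.length = k := by
    obtain ⟨Q, G, a, b, h⟩ := exists_isBypass hC htwo hne hr
    exact ⟨_, Q, G, a, b, h, rfl⟩
  obtain ⟨Q, G, a, b, h, hk⟩ := Nat.find_spec hex
  have hmin : ∀ Q' G' a' b', IsBypass A C Q' G' a' b' → G.length ≤ G'.length :=
    fun Q' G' a' b' h' => hk ▸ Nat.find_min' hex ⟨Q', G', a', b', h', rfl⟩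
  have hno_enter : ∀ z ∈ G, ∀ w ∉ C, ReachOff A C w b → ¬ A z w := by
    intro z hz w hw hwb hzw
    obtain ⟨G₁, G₂, rfl⟩ := List.append_of_mem hz
    have := hmin _ _ _ _ (h.enter_at hw hzw hwb)
    simp at this
    omega
  have hno_leave : ∀ z ∈ G, ∀ w ∉ C, ReachOff A C a w → ¬ A w z := by
    intro z hz w hw haw hwz
    obtain ⟨G₁, G₂, rfl⟩ := List.append_of_mem hz
    have := hmin _ _ _ _ (h.leave_at hw hwz haw)
    simp at this
  have hG0 := h.gap_ne_nil hmax
  obtain ⟨g₁, hg₁⟩ : ∃ g, G.head? = some g := ⟨_, List.head?_eq_some_head hG0⟩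
  obtain ⟨g₂, hg₂⟩ : ∃ g, G.getLast? = some g := ⟨_, List.getLast?_eq_getLast_of_ne_nil hG0⟩
  have hg₁G : g₁ ∈ G := List.mem_of_head? hg₁
  have hg₂G : g₂ ∈ G := List.mem_of_getLast? hg₂
  have haC := h.left_notMem
  set R := (Finset.univ.filter fun v => v ∉ C).toList with hR
  have hmemR : ∀ v, v ∈ R ↔ v ∉ C := by simp [hR]
  have hall : (Q ++ G ++ R).Perm (Finset.univ : Finset V).toList := by
    refine (List.perm_ext_iff_of_nodup ?_ (Finset.nodup_toList _)).2 fun v => ?_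
    · exact List.nodup_append'.2 ⟨h.cyclic.nodup, Finset.nodup_toList _,
        fun v hv hv' => (hmemR v).1 hv' (h.perm.mem_iff.1 hv)⟩
    · rw [List.mem_append, h.perm.mem_iff, hmemR]
      simp [em]
  have hcount : ∀ p : V → Prop, ∀ [DecidablePred p], (Finset.univ.filter p).card =
      Q.countP p + G.countP p + R.countP p := by
    intro p _
    rw [← List.countP_append, ← List.countP_append, hall.countP_eq, List.countP_eq_length_filter,
      ← Finset.length_toList]
    refine List.Perm.length_eq ((List.perm_ext_iff_of_nodup (Finset.nodup_toList _)
      ((Finset.nodup_toList _).filter _)).2 fun v => by simp)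
  have hcard : Fintype.card V = Q.length + G.length + R.length := by
    rw [← List.length_append, ← List.length_append, hall.length_eq]
    simp
  have h₁ := hdeg a g₁ (hno_leave g₁ hg₁G a haC .refl)
  have h₂ := hdeg g₂ a (hno_enter g₂ hg₂G a haC h.reach)
  have hR₁ : R.countP (A a ·) + R.countP (A · g₁) ≤ R.length := by
    refine List.countP_add_countP_le_length _ _ _ fun w hw => ?_
    rw [hmemR] at hw
    simp only [decide_eq_true_eq, not_and]
    exact fun haw => hno_leave g₁ hg₁G w hw (.single ⟨haC, hw, haw⟩)
  have hR₂ : R.countP (A g₂ ·) + R.countP (A · a) ≤ R.length := by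
    refine List.countP_add_countP_le_length _ _ _ fun w hw => ?_
    rw [hmemR] at hw
    simp only [decide_eq_true_eq, not_and]
    exact fun hgw hwa => hno_enter g₂ hg₂G w hw (h.reach.head ⟨hw, haC, hwa⟩) hgw
  have hGa : G.countP (A a ·) = 0 :=
    List.countP_eq_zero.2 fun z hz => by simpa using hno_leave z hz a haC .refl
  have hGa' : G.countP (A · a) = 0 :=
    List.countP_eq_zero.2 fun z hz => by simpa using hno_enter z hz a haC h.reach
  have hG₁ : G.countP (A · g₁) ≤ G.length := List.countP_le_length
  have hG₂ : G.countP (A g₂ ·) ≤ G.length := List.countP_le_length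
  have hQ₁ : Q.countP (A · a) + Q.countP (A a ·) < Q.length + 2 := by
    by_contra! hle
    obtain ⟨l₁, z, w, l₂, hQ, hz, hw⟩ := List.exists_consecutive_of_length_add_two_le _ _ _ hle
    exact h.no_insert_vertex hmax hQ (by simpa using hz) (by simpa using hw)
  have hQ₂ : Q.countP (A · g₁) + Q.countP (A g₂ ·) < Q.length + 2 := by
    by_contra! hle
    obtain ⟨l₁, z, w, l₂, hQ, hz, hw⟩ := List.exists_consecutive_of_length_add_two_le _ _ _ hle
    exact h.no_insert_gap hmax hQ hG0 (by simpa [hg₁] using hz) (by simpa [hg₂] using hw)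
  rw [hcount, hcount, hcard] at h₁ h₂
  omega

theorem List.IsChain.imp_of_nodup {α : Type*} {r r' : α → α → Prop} {x : α} {m : List α}
    (hc : (x :: m).IsChain r) (hn : (x :: m).Nodup)
    (himp : ∀ y ∈ m, ∀ x, x ≠ y → r x y → r' x y) : (x :: m).IsChain r' := by
  induction m generalizing x with
  | nil => simp
  | cons y m ih =>
    rw [List.isChain_cons_cons] at hc ⊢
    refine ⟨himp y List.mem_cons_self x (fun h => ?_) hc.1,
      ih hc.2 hn.of_cons fun z hz => himp z (List.mem_cons_of_mem _ hz)⟩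
    simp [h] at hn

theorem isDipath_cons_append_singleton {V : Type*} {A : V → V → Prop} {s t : V} {m : List V}
    (hc : (s :: m).IsChain A) (hn : (s :: m).Nodup) (ht : t ∉ s :: m)
    (hl : ∀ x ∈ (s :: m).getLast?, A x t) : IsDipath A (s :: m ++ [t]) s t := by
  refine ⟨by simp, List.isChain_append.2 ⟨hc, by simp, by simpa using hl⟩, ?_, rfl,
    by rw [List.getLast?_append_of_ne_nil _ (by simp)]; rfl⟩
  exact List.nodup_append'.2 ⟨hn, by simp, by simpa using ht⟩

/-- Let `D` be a digraph of order `n ≥ 4`. If `d⁺(x) + d⁻(y) ≥ n + 2` for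
every ordered pair of distinct vertices `x, y` with `xy` not an arc of `D`,
then `D` is paired many-to-many `2`-coverable. -/
theorem paired_mtm_two_of_ore {V : Type*} [Fintype V]
    (A : V → V → Prop) (hirr : Irreflexive A)
    (hn : 4 ≤ Fintype.card V)
    (hdeg : ∀ x y : V, x ≠ y → ¬ A x y →
      Fintype.card V + 2 ≤ outDeg A x + inDeg A y) :
    PairedMtmCoverable A 2 := by
  classical
  intro s t hs ht hst
  have hs01 : s 0 ≠ s 1 := fun h => absurd (hs h) (by decide)
  have ht01 : t 0 ≠ t 1 := fun h => absurd (ht h) (by decide)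
  -- Identify `s 0` with `t 1` and `s 1` with `t 0`; the arcs into a vertex `y` of the quotient
  -- are the arcs of `A` into `φ y`.
  let φ : V → V := fun y => if y = s 0 then t 1 else if y = s 1 then t 0 else y
  have hφ0 : φ (s 0) = t 1 := by simp [φ]
  have hφ1 : φ (s 1) = t 0 := by simp [φ, hs01.symm]
  have hφ : ∀ y, y ≠ s 0 → y ≠ s 1 → φ y = y := fun y h0 h1 => by simp [φ, h0, h1]
  let W := {v : V // v ≠ t 0 ∧ v ≠ t 1}
  let B : W → W → Prop := fun x y => x = y ∨ A x.1 (φ y.1)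
  let σ : Fin 2 → W := fun i => ⟨s i, hst i 0, hst i 1⟩
  have hcardW : Fintype.card W + 2 = Fintype.card V := by
    have h1 : Fintype.card W = (Finset.univ \ {t 0, t 1} : Finset V).card :=
      Fintype.card_of_subtype _ fun x => by simp
    rw [h1, Finset.card_sdiff_of_subset (Finset.subset_univ _), Finset.card_pair ht01,
      Finset.card_univ]
    omega
  have hout : ∀ x : W, outDeg A x.1 ≤ (Finset.univ.filter fun y => B x y).card + 1 := by
    intro x
    have hsub : insert x.1 (Finset.univ.filter fun z => A x.1 z) \ {s 0, s 1} ⊆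
        (Finset.univ.filter fun y => B x y).image fun y => φ y.1 := by
      intro z hz
      simp only [Finset.mem_sdiff, Finset.mem_insert, Finset.mem_filter, Finset.mem_univ,
        true_and, Finset.mem_singleton, not_or] at hz
      obtain ⟨hz, hz0, hz1⟩ := hz
      rw [Finset.mem_image]
      rcases hz with rfl | hz
      · exact ⟨x, by simp [B], hφ _ hz0 hz1⟩
      by_cases h0 : z = t 0
      · exact ⟨σ 1, by simpa [B, σ, hφ1] using Or.inr (h0 ▸ hz), by simp [σ, hφ1, h0]⟩
      by_cases h1 : z = t 1
      · exact ⟨σ 0, by simpa [B, σ, hφ0] using Or.inr (h1 ▸ hz), by simp [σ, hφ0, h1]⟩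
      · exact ⟨⟨z, h0, h1⟩, by simpa [B, hφ z hz0 hz1] using Or.inr hz, hφ z hz0 hz1⟩
    have h1 := (Finset.card_le_card hsub).trans Finset.card_image_le
    have h2 := Finset.le_card_sdiff {s 0, s 1} (insert x.1 (Finset.univ.filter fun z => A x.1 z))
    rw [Finset.card_insert_of_notMem (by simpa using hirr x.1), Finset.card_pair hs01] at h2
    rw [outDeg, Nat.card_eq_fintype_card, Fintype.card_subtype]
    omega
  have hin : ∀ y : W, inDeg A (φ y.1) ≤ (Finset.univ.filter fun x => B x y).card + 1 := by
    intro y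
    have hsub : insert (φ y.1) (Finset.univ.filter fun z => A z (φ y.1)) \ {t 0, t 1} ⊆
        (Finset.univ.filter fun x => B x y).image Subtype.val := by
      intro z hz
      simp only [Finset.mem_sdiff, Finset.mem_insert, Finset.mem_filter, Finset.mem_univ,
        true_and, Finset.mem_singleton, not_or] at hz
      obtain ⟨hz, hz0, hz1⟩ := hz
      rw [Finset.mem_image]
      rcases hz with rfl | hz
      · refine ⟨y, by simp [B], ?_⟩
        by_cases h0 : y.1 = s 0
        · exact absurd (h0 ▸ hφ0) hz1
        by_cases h1 : y.1 = s 1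
        · exact absurd (h1 ▸ hφ1) hz0
        exact (hφ _ h0 h1).symm
      · exact ⟨⟨z, hz0, hz1⟩, by simpa [B] using Or.inr hz, rfl⟩
    have h1 := (Finset.card_le_card hsub).trans Finset.card_image_le
    have h2 := Finset.le_card_sdiff {t 0, t 1}
      (insert (φ y.1) (Finset.univ.filter fun z => A z (φ y.1)))
    rw [Finset.card_insert_of_notMem (by simpa using hirr (φ y.1)), Finset.card_pair ht01] at h2
    rw [inDeg, Nat.card_eq_fintype_card, Fintype.card_subtype]
    omega
  obtain ⟨C, hC, hmem⟩ := exists_isCyclicList_of_ore B (fun x => Or.inl rfl) (by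
    intro x y hxy
    simp only [B, not_or] at hxy
    have hne : x.1 ≠ φ y.1 := by
      by_cases h0 : y.1 = s 0
      · rw [h0, hφ0]
        exact x.2.2
      by_cases h1 : y.1 = s 1
      · rw [h1, hφ1]
        exact x.2.1
      rw [hφ _ h0 h1]
      exact fun h => hxy.1 (Subtype.ext h)
    have := hdeg _ _ hne hxy.2
    have := hout x
    have := hin y
    omega)
  obtain ⟨L, hL, hLmem⟩ : ∃ L, IsCyclicList B (σ 0 :: L) ∧ ∀ v, v ∈ σ 0 :: L := by
    obtain ⟨l₁, l₂, rfl⟩ := List.append_of_mem (hmem (σ 0))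
    exact ⟨l₂ ++ l₁, hC.append_comm, fun v => (List.perm_append_comm.mem_iff).1 (hmem v)⟩
  have hσ : σ 1 ≠ σ 0 := fun h => hs01 (congrArg Subtype.val h).symm
  obtain ⟨L₀, L₁, rfl⟩ := List.append_of_mem
    ((List.mem_cons.1 (hLmem (σ 1))).resolve_left hσ)
  obtain ⟨hnd, hch, hlk⟩ := hL
  rw [← List.cons_append] at hnd hch hlk hLmem
  obtain ⟨hnd0, hnd1, hdisj⟩ := List.nodup_append'.1 hnd
  obtain ⟨hch0, hch1, hlk01⟩ := List.isChain_append.1 hch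
  have hstep : ∀ l : List W, σ 0 ∉ l → σ 1 ∉ l → ∀ y ∈ l, ∀ x, x ≠ y → B x y → A x.1 y.1 := by
    intro l h0 h1 y hy x hxy hB
    have := hB.resolve_left hxy
    rwa [hφ] at this
    · exact fun h => h0 ((Subtype.ext h : y = σ 0) ▸ hy)
    · exact fun h => h1 ((Subtype.ext h : y = σ 1) ▸ hy)
  have hmain : ∀ (i j : Fin 2) (l : List W), (σ i :: l).Nodup → (σ i :: l).IsChain B →
      σ j ∉ σ i :: l → (∀ k, k = i ∨ k = j) → φ (s j) = t i →
      (∀ x ∈ (σ i :: l).getLast?, B x (σ j)) →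
      IsDipath A (s i :: l.map Subtype.val ++ [t i]) (s i) (t i) := by
    intro i j l hnd hch hj hij hφj hlast
    have hout : ∀ k, σ k ∉ l := fun k => by
      rcases hij k with rfl | rfl
      · exact (List.nodup_cons.1 hnd).1
      · exact fun h => hj (List.mem_cons_of_mem _ h)
    have hmap : s i :: l.map Subtype.val = (σ i :: l).map Subtype.val := rfl
    apply isDipath_cons_append_singleton <;> rw [hmap]
    · rw [List.isChain_map]
      exact hch.imp_of_nodup hnd (hstep l (hout 0) (hout 1))
    · exact hnd.map Subtype.val_injective
    · rw [List.mem_map]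
      rintro ⟨x, -, hx⟩
      have h0 := x.2.1
      have h1 := x.2.2
      fin_cases i <;> simp_all
    · intro x hx
      rw [List.getLast?_map, Option.mem_map] at hx
      obtain ⟨x, hx, rfl⟩ := hx
      have := (hlast x hx).resolve_left fun h => hj (h ▸ List.mem_of_getLast? hx)
      rwa [show (σ j).1 = s j from rfl, hφj] at this
  have hP0 := hmain 0 1 L₀ hnd0 hch0 (fun h => hdisj h List.mem_cons_self)
    (by decide) hφ1 (fun x hx => hlk01 x hx _ rfl)
  have hP1 := hmain 1 0 L₁ hnd1 hch1 (fun h => hdisj List.mem_cons_self h)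
    (by decide) hφ0 (fun x hx => hlk x
      (by rw [List.getLast?_append_of_ne_nil _ (by simp)]; exact hx) _ rfl)
  have hmem0 : ∀ v, v ∈ s 0 :: L₀.map Subtype.val ++ [t 0] ↔
      (∃ x ∈ σ 0 :: L₀, x.1 = v) ∨ v = t 0 := fun v => by
    rw [show s 0 :: L₀.map Subtype.val = (σ 0 :: L₀).map Subtype.val from rfl,
      List.mem_append, List.mem_map, List.mem_singleton]
  have hmem1 : ∀ v, v ∈ s 1 :: L₁.map Subtype.val ++ [t 1] ↔
      (∃ x ∈ σ 1 :: L₁, x.1 = v) ∨ v = t 1 := fun v => by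
    rw [show s 1 :: L₁.map Subtype.val = (σ 1 :: L₁).map Subtype.val from rfl,
      List.mem_append, List.mem_map, List.mem_singleton]
  have hdisjP : ∀ v, v ∈ s 0 :: L₀.map Subtype.val ++ [t 0] →
      v ∉ s 1 :: L₁.map Subtype.val ++ [t 1] := by
    intro v
    rw [hmem0, hmem1]
    rintro (⟨x, hx, rfl⟩ | rfl) (⟨y, hy, hxy⟩ | hy)
    · exact hdisj hx (Subtype.ext hxy ▸ hy)
    · exact x.2.2 hy
    · exact y.2.1 hxy
    · exact ht01 hy
  refine ⟨![s 0 :: L₀.map Subtype.val ++ [t 0], s 1 :: L₁.map Subtype.val ++ [t 1]],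
    ?_, ?_, ?_⟩
  · exact Fin.forall_fin_two.2 ⟨hP0, hP1⟩
  · refine Fin.forall_fin_two.2 ⟨Fin.forall_fin_two.2 ⟨fun h => absurd rfl h, fun _ => hdisjP⟩,
      Fin.forall_fin_two.2 ⟨fun _ v h1 h0 => hdisjP v h0 h1, fun h => absurd rfl h⟩⟩
  · intro v
    by_cases h0 : v = t 0
    · exact ⟨0, (hmem0 v).2 (Or.inr h0)⟩
    by_cases h1 : v = t 1
    · exact ⟨1, (hmem1 v).2 (Or.inr h1)⟩
    rcases List.mem_append.1 (hLmem ⟨v, h0, h1⟩) with h | h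
    · exact ⟨0, (hmem0 v).2 (Or.inl ⟨_, h, rfl⟩)⟩
    · exact ⟨1, (hmem1 v).2 (Or.inl ⟨_, h, rfl⟩)⟩
end

section
/- For every integer n ≥ 9, there exists a digraph D on n vertices such that d⁺_D(x) + d⁻_D(y) = n + 1 for every ordered pair of distinct vertices x, y with xy not an arc of D, and D is not paired many-to-many 2-coverable. -/
/-- An interior vertex of a directed path has a predecessor other than the
terminal vertex and a successor other than the initial vertex. -/
theorem IsDipath.exists_pred_succ {V : Type*} {A : V → V → Prop} {p : List V} {s t v : V}
    (hp : IsDipath A p s t) (hv : v ∈ p) (hs : v ≠ s) (ht : v ≠ t) :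
    (∃ u ∈ p, A u v ∧ u ≠ t) ∧ ∃ w ∈ p, A v w ∧ w ≠ s := by
  obtain ⟨-, hc, hn, hh, hl⟩ := hp
  obtain ⟨a, b, rfl⟩ := List.append_of_mem hv
  rcases List.eq_nil_or_concat' a with rfl | ⟨a, u, rfl⟩
  · simp_all
  rcases b with _ | ⟨w, b⟩
  · simp_all
  have hu : A u v ∧ A v w := by
    replace hc : List.IsChain A (a ++ [u] ++ v :: w :: b) := hc
    have hc' : List.IsChain A (a ++ ([u, v, w] ++ b)) := by simpa using hc
    simpa using hc'.right_of_append.left_of_append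
  have ht' : t ∈ w :: b := by
    have : (w :: b).getLast? = some t := by simpa [List.getLast?_append] using hl
    exact List.mem_of_getLast? this
  have hs' : s ∈ a ++ [u] := by
    have : (a ++ [u]).head? = some s := by
      cases a <;> simpa using hh
    exact List.mem_of_head? this
  have hd := List.disjoint_of_nodup_append hn
  refine ⟨⟨u, by simp, hu.1, ?_⟩, w, by simp, hu.2, ?_⟩
  · rintro rfl
    exact hd (by simp) (List.mem_cons_of_mem _ ht')
  · rintro rfl
    exact hd hs' (by simp)

/-- The complete digraph on `Fin n` with arcs at the vertex `4` removed so that its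
in-neighbours are `0, 1, 3` and its out-neighbours are `0, 2, 3`. -/
def bottleneckArc (n : ℕ) (x y : Fin n) : Prop :=
  x ≠ y ∧ (y.val = 4 → x.val = 0 ∨ x.val = 1 ∨ x.val = 3) ∧
    (x.val = 4 → y.val = 0 ∨ y.val = 2 ∨ y.val = 3)

theorem natCard_subtype_eq_of_mem_iff {V : Type*} {p : V → Prop} (s : Finset V)
    (h : ∀ v, p v ↔ v ∈ s) : Nat.card {v // p v} = s.card := by
  simp [h]

theorem bottleneckArc_degree_sum {n : ℕ} (hn : 5 ≤ n) {x y : Fin n} (hxy : x ≠ y)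
    (h : ¬ bottleneckArc n x y) :
    outDeg (bottleneckArc n) x + inDeg (bottleneckArc n) y = n + 1 := by
  have card_three (a b c : Fin n) (hab : a ≠ b) (hac : a ≠ c) (hbc : b ≠ c) :
      ({a, b, c} : Finset (Fin n)).card = 3 := Finset.card_eq_three.2 ⟨a, b, c, hab, hac, hbc, rfl⟩
  have card_compl (a b : Fin n) (hab : a ≠ b) :
      ({a, b}ᶜ : Finset (Fin n)).card = n - 2 := by
    rw [Finset.card_compl, Finset.card_pair hab, Fintype.card_fin]
  unfold outDeg inDeg
  by_cases hy : y.val = 4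
  · have hx : ¬ (x.val = 0 ∨ x.val = 1 ∨ x.val = 3) ∧ x.val ≠ 4 := by
      unfold bottleneckArc at h; grind
    rw [natCard_subtype_eq_of_mem_iff {x, y}ᶜ, card_compl x y hxy,
      natCard_subtype_eq_of_mem_iff
        {⟨0, by omega⟩, ⟨1, by omega⟩, ⟨3, by omega⟩}, card_three]
    · omega
    iterate 3 simp
    · intro v
      simp only [bottleneckArc, Finset.mem_insert, Finset.mem_singleton, Fin.ext_iff]
      omega
    · intro v
      simp only [bottleneckArc, Finset.mem_compl, Finset.mem_insert, Finset.mem_singleton,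
        ne_eq, Fin.ext_iff]
      omega
  · have hx : x.val = 4 ∧ ¬ (y.val = 0 ∨ y.val = 2 ∨ y.val = 3) := by
      unfold bottleneckArc at h; grind
    rw [natCard_subtype_eq_of_mem_iff (p := fun w => bottleneckArc n w y) {x, y}ᶜ,
      card_compl x y hxy,
      natCard_subtype_eq_of_mem_iff
        {⟨0, by omega⟩, ⟨2, by omega⟩, ⟨3, by omega⟩}, card_three]
    · omega
    iterate 3 simp
    · intro v
      simp only [bottleneckArc, Finset.mem_insert, Finset.mem_singleton, Fin.ext_iff]
      omega
    · intro v
      simp only [bottleneckArc, Finset.mem_compl, Finset.mem_insert, Finset.mem_singleton,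
        ne_eq, Fin.ext_iff]
      omega

theorem not_pairedMtmCoverable_bottleneckArc {n : ℕ} (hn : 5 ≤ n) :
    ¬ PairedMtmCoverable (bottleneckArc n) 2 := by
  intro h
  obtain ⟨P, hP, hd, hc⟩ := h ![⟨0, by omega⟩, ⟨2, by omega⟩] ![⟨1, by omega⟩, ⟨3, by omega⟩]
    (by intro i j; fin_cases i <;> fin_cases j <;> simp)
    (by intro i j; fin_cases i <;> fin_cases j <;> simp)
    (by intro i j; fin_cases i <;> fin_cases j <;> simp)
  have h₀ := hP 0
  have h₁ := hP 1
  simp only [Matrix.cons_val_zero, Matrix.cons_val_one] at h₀ h₁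
  obtain ⟨i, hi⟩ := hc ⟨4, by omega⟩
  obtain rfl | rfl : i = 0 ∨ i = 1 := by omega
  · obtain ⟨-, w, hw, ⟨-, -, hA⟩, hne⟩ := h₀.exists_pred_succ hi (by simp) (by simp)
    have hw' := hd 0 1 (by simp) w hw
    obtain h | h | h := hA rfl
    · exact hne (Fin.ext h)
    · exact hw' (Fin.ext (b := ⟨2, by omega⟩) h ▸ List.mem_of_head? h₁.2.2.2.1)
    · exact hw' (Fin.ext (b := ⟨3, by omega⟩) h ▸ List.mem_of_getLast? h₁.2.2.2.2)
  · obtain ⟨⟨u, hu, ⟨-, hA, -⟩, hne⟩, -⟩ := h₁.exists_pred_succ hi (by simp) (by simp)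
    have hu' := hd 1 0 (by simp) u hu
    obtain h | h | h := hA rfl
    · exact hu' (Fin.ext (b := ⟨0, by omega⟩) h ▸ List.mem_of_head? h₀.2.2.2.1)
    · exact hu' (Fin.ext (b := ⟨1, by omega⟩) h ▸ List.mem_of_getLast? h₀.2.2.2.2)
    · exact hne (Fin.ext h)

/-- For every `n ≥ 9`, there is a digraph on `n` vertices with
`d⁺(x) + d⁻(y) = n + 1` for every ordered pair of distinct vertices `x, y`
with `xy` not an arc, which is not paired many-to-many `2`-coverable. -/
theorem exists_not_paired_mtm_two_coverable (n : ℕ) (hn : 9 ≤ n) :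
    ∃ A : Fin n → Fin n → Prop, Irreflexive A ∧
      (∀ x y : Fin n, x ≠ y → ¬ A x y →
        outDeg A x + inDeg A y = n + 1) ∧
      ¬ PairedMtmCoverable A 2 := by
  exact ⟨bottleneckArc n, fun _ h => h.1 rfl, fun _ _ => bottleneckArc_degree_sum (by omega),
    not_pairedMtmCoverable_bottleneckArc (by omega)⟩
end

section
/- Let D be a digraph of order n ≥ 3k, where k ≥ 2 is an integer. If δ⁰(D) ≥ ⌈(n + k)/2⌉, then D is one-to-many k-coverable. -/
/-- The digraph with arc relation `A` is one-to-many `k`-coverable: for every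
vertex `s` and every set `T = {t 0, …, t (k-1)}` of `k` vertices distinct
from `s`, there are `k` directed paths covering all vertices, path `i` going
from `s` to `t i`, any two of them meeting exactly in `s`. -/
def OneToManyCoverable {V : Type*} (A : V → V → Prop) (k : ℕ) : Prop :=
  ∀ (s : V) (t : Fin k → V), Function.Injective t → (∀ i, t i ≠ s) →
    ∃ P : Fin k → List V,
      (∀ i, IsDipath A (P i) s (t i)) ∧
      (∀ i j, i ≠ j → ∀ v, v ∈ P i → v ∈ P j → v = s) ∧
      (∀ v : V, ∃ i, v ∈ P i)

open Classical in
theorem List.exists_longest {W : Type*} [Fintype W] (P : List W → Prop)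
    (hP : ∀ L, P L → L.Nodup) (hne : ∃ L, P L) :
    ∃ L, P L ∧ ∀ L', P L' → L'.length ≤ L.length := by
  obtain ⟨L₀, h₀⟩ := hne
  have hb : ∀ L, P L → L.length ≤ Fintype.card W := fun L h => (hP L h).length_le_card
  obtain ⟨L, hL, hlen⟩ := Nat.findGreatest_spec
    (P := fun m => ∃ L, P L ∧ L.length = m) (hb L₀ h₀) ⟨L₀, h₀, rfl⟩
  refine ⟨L, hL, fun L' h' => ?_⟩
  rw [hlen]
  exact Nat.le_findGreatest (hb L' h') ⟨L', h', rfl⟩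

theorem List.exists_first {W : Type*} (P : W → Prop) (L : List W) (h : ∃ x ∈ L, P x) :
    ∃ N₁ x N₂, L = N₁ ++ x :: N₂ ∧ P x ∧ ∀ y ∈ N₁, ¬ P y := by
  induction L with
  | nil => simp at h
  | cons a L ih =>
    by_cases ha : P a
    · exact ⟨[], a, L, rfl, ha, by simp⟩
    · obtain ⟨N₁, x, N₂, rfl, hx, hN⟩ := ih (by
        obtain ⟨x, hx, hPx⟩ := h
        rcases List.mem_cons.1 hx with rfl | hx
        · exact absurd hPx ha
        · exact ⟨x, hx, hPx⟩)
      refine ⟨a :: N₁, x, N₂, rfl, hx, ?_⟩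
      intro y hy
      rcases List.mem_cons.1 hy with rfl | hy
      · exact ha
      · exact hN y hy

theorem List.exists_last {W : Type*} (P : W → Prop) (L : List W) (h : ∃ x ∈ L, P x) :
    ∃ N₁ x N₂, L = N₁ ++ x :: N₂ ∧ P x ∧ ∀ y ∈ N₂, ¬ P y := by
  obtain ⟨N₁, x, N₂, hL, hx, hN⟩ := List.exists_first P L.reverse (by simpa using h)
  refine ⟨N₂.reverse, x, N₁.reverse, ?_, hx, by simpa using hN⟩
  rw [← List.reverse_reverse L, hL]
  simp

theorem List.isChain_of_forall_split {W : Type*} {R : W → W → Prop} {L : List W}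
    (h : ∀ N₁ x y N₂, L = N₁ ++ x :: y :: N₂ → R x y) : L.IsChain R := by
  induction L with
  | nil => simp
  | cons a L ih =>
    cases L with
    | nil => simp
    | cons b L =>
      rw [List.isChain_cons_cons]
      exact ⟨h [] a b L rfl, ih fun N₁ x y N₂ e => h (a :: N₁) x y N₂ (by rw [e]; rfl)⟩

open Classical in
theorem List.countP_dropLast_add_countP_le {W : Type*} (S B : W → Prop) (a : W) (L : List W)
    (h : (a :: L).IsChain fun x y => ¬ (S x ∧ B y)) :
    (a :: L).dropLast.countP (fun x => S x) + L.countP (fun x => B x) ≤ L.length := by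
  induction L generalizing a with
  | nil => simp
  | cons b L ih =>
    rw [List.isChain_cons_cons] at h
    have := ih b h.2
    have h1 : (if S a then 1 else 0) + (if B b then 1 else 0) ≤ 1 := by
      have := h.1
      split_ifs <;> simp_all
    simp only [List.dropLast_cons_cons, List.countP_cons, List.length_cons,
      decide_eq_true_eq] at this ⊢
    omega

/-- The list `M` is a directed cycle of the relation `r`, listed from the vertex `b`. -/
def IsCycleFrom {W : Type*} (r : W → W → Prop) (b : W) (M : List W) : Prop :=
  M.head? = some b ∧ M.Nodup ∧ (M ++ [b]).IsChain r

theorem IsCycleFrom.rotate {W : Type*} {r : W → W → Prop} {b c : W} {M : List W}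
    (h : IsCycleFrom r b M) (hc : c ∈ M) : ∃ M', M'.Perm M ∧ IsCycleFrom r c M' := by
  obtain ⟨N₁, N₂, rfl⟩ := List.append_of_mem hc
  obtain ⟨h1, h2, h3⟩ := h
  have hp : (c :: N₂ ++ N₁).Perm (N₁ ++ c :: N₂) := List.perm_append_comm
  refine ⟨c :: N₂ ++ N₁, hp, rfl, hp.nodup_iff.2 h2, ?_⟩
  cases N₁ with
  | nil => simp at h1; subst h1; simpa using h3
  | cons a N₁ =>
    simp only [List.cons_append, List.head?_cons, Option.some.injEq] at h1
    subst h1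
    have e1 : (a :: N₁ ++ c :: N₂) ++ [a] = (a :: N₁) ++ c :: (N₂ ++ [a]) := by simp
    have e2 : (c :: N₂ ++ a :: N₁) ++ [c] = (c :: N₂) ++ a :: (N₁ ++ [c]) := by simp
    rw [e1, List.isChain_split] at h3
    rw [e2, List.isChain_split]
    simpa [and_comm] using h3

open Classical in
theorem exists_cycle_of_outDegree {W : Type*} [Fintype W] [Nonempty W] (r : W → W → Prop)
    (hirr : ∀ x, ¬ r x x) (p : ℕ) (hp : 1 ≤ p)
    (hout : ∀ v, p ≤ (Finset.univ.filter fun w => r v w).card) :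
    ∃ b M, IsCycleFrom r b M ∧ p + 1 ≤ M.length := by
  obtain ⟨L, ⟨hne, hnd, hch⟩, hmax⟩ := List.exists_longest
    (fun L : List W => L ≠ [] ∧ L.Nodup ∧ L.IsChain r) (fun L h => h.2.1)
    ⟨[Classical.arbitrary W], by simp⟩
  obtain ⟨L', z, rfl⟩ : ∃ L' z, L = L' ++ [z] :=
    ⟨_, _, (List.dropLast_append_getLast hne).symm⟩
  have hmem : ∀ y, r z y → y ∈ L' ++ [z] := by
    intro y hy
    by_contra hn
    have := hmax (L' ++ [z] ++ [y]) ⟨by simp, by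
      rw [List.nodup_append]
      refine ⟨hnd, by simp, ?_⟩
      rintro a ha b hb rfl
      simp only [List.mem_singleton] at hb
      exact hn (hb ▸ ha), by
      rw [List.isChain_append]
      refine ⟨hch, by simp, ?_⟩
      simpa using hy⟩
    simp at this
  obtain ⟨y, hy⟩ : ∃ y, r z y := by
    have := Finset.card_pos.1 (hp.trans (hout z))
    obtain ⟨y, hy⟩ := this
    exact ⟨y, by simpa using hy⟩
  obtain ⟨N₁, x, N₂, hL, hx, hN⟩ := List.exists_first (fun y => r z y) _ ⟨y, hmem y hy, hy⟩
  have hz : (x :: N₂).getLast? = some z := by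
    have := congrArg List.getLast? hL
    rw [List.getLast?_append_of_ne_nil _ (by simp : x :: N₂ ≠ [])] at this
    simpa using this.symm
  rw [hL] at hnd hch hmem
  refine ⟨x, x :: N₂, ⟨rfl, (List.nodup_append.1 hnd).2.1, ?_⟩, ?_⟩
  · rw [List.isChain_append]
    refine ⟨(List.isChain_append.1 hch).2.1, by simp, ?_⟩
    rw [hz]
    simpa using hx
  · have hsub : insert z (Finset.univ.filter fun w => r z w) ⊆ (x :: N₂).toFinset := by
      intro v hv
      rw [Finset.mem_insert] at hv
      rw [List.mem_toFinset]
      rcases hv with rfl | hv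
      · exact List.mem_of_getLast? hz
      · have hv : r z v := by simpa using hv
        rcases List.mem_append.1 (hmem v hv) with h | h
        · exact absurd hv (hN v h)
        · exact h
    have h1 := Finset.card_le_card hsub
    rw [Finset.card_insert_of_notMem (by simpa using hirr z)] at h1
    have h2 := hout z
    have h3 := List.toFinset_card_le (x :: N₂)
    omega

open Classical in
theorem IsCycleFrom.countP_add_countP_le {W : Type*} {r : W → W → Prop}
    {b : W} {M Q : List W} {u w : W} (hM : IsCycleFrom r b M)
    (hmax : ∀ M', IsCycleFrom r b M' → M'.length ≤ M.length)
    (hQnd : Q.Nodup) (hQch : Q.IsChain r) (hQM : ∀ x ∈ Q, x ∉ M)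
    (hu : Q.head? = some u) (hw : Q.getLast? = some w) (hwb : r w b) (hS : ∃ x ∈ M, r x u) :
    M.countP (fun x => r x u) + M.countP (fun y => r w y) + Q.length ≤ M.length + 1 := by
  have hQne : Q ≠ [] := by rintro rfl; simp at hu
  have hQpos : 1 ≤ Q.length := List.length_pos_of_ne_nil hQne
  obtain ⟨hhd, hnd, hch⟩ := hM
  have hreplace : ∀ N₁ x N₂ N₃, M = N₁ ++ x :: (N₂ ++ N₃) → r x u →
      (∀ y ∈ (N₃ ++ [b]).head?, r w y) → Q.length ≤ N₂.length := by
    intro N₁ x N₂ N₃ e hx hy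
    have := hmax (N₁ ++ x :: (Q ++ N₃)) ⟨?_, ?_, ?_⟩
    · rw [e] at this
      simp only [List.length_append, List.length_cons] at this
      omega
    · rw [e] at hhd
      cases N₁ <;> simpa using hhd
    · rw [e] at hnd hQM
      clear * - hnd hQM hQnd
      simp only [List.nodup_append, List.nodup_cons, List.mem_append, List.mem_cons] at *
      grind
    · have e1 : M ++ [b] = N₁ ++ x :: (N₂ ++ (N₃ ++ [b])) := by simp [e]
      have e2 : N₁ ++ x :: (Q ++ N₃) ++ [b] = N₁ ++ x :: (Q ++ (N₃ ++ [b])) := by simp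
      rw [e1, List.isChain_split] at hch
      rw [e2, List.isChain_split]
      refine ⟨hch.1, ?_⟩
      have h3 : (N₃ ++ [b]).IsChain r :=
        (List.isChain_append.1 (List.IsChain.tail hch.2)).2.1
      rw [List.isChain_cons, List.isChain_append]
      refine ⟨?_, hQch, h3, ?_⟩
      · intro y hy
        rw [List.head?_append_of_ne_nil _ hQne, hu] at hy
        simp at hy
        exact hy ▸ hx
      · rw [hw]
        simpa using hy
  obtain ⟨M₁, x, M₂, e, hx, hM₂⟩ := List.exists_last (fun x => r x u) M hS
  have hlen : Q.length ≤ M₂.length := by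
    apply hreplace M₁ x M₂ [] (by simpa using e) hx
    simpa using hwb
  have htake : (M₂.take Q.length).countP (fun y => r w y) = 0 := by
    rw [List.countP_eq_zero]
    intro y hy hwy
    have hwy : r w y := by simpa using hwy
    obtain ⟨N₂, N₃, e'⟩ := List.append_of_mem hy
    have e2 : M₂ = N₂ ++ (y :: N₃ ++ M₂.drop Q.length) := by
      conv_lhs => rw [← List.take_append_drop Q.length M₂, e']
      simp
    have := hreplace M₁ x N₂ (y :: N₃ ++ M₂.drop Q.length) (by rw [← e2]; exact e) hx
      (by simpa using hwy)
    have h4 := congrArg List.length e'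
    simp at h4
    omega
  have hB₂ : M₂.countP (fun y => r w y) + Q.length ≤ M₂.length := by
    have h1 := List.countP_append (p := fun y => decide (r w y))
      (l₁ := M₂.take Q.length) (l₂ := M₂.drop Q.length)
    rw [List.take_append_drop, htake] at h1
    have h2 := List.countP_le_length (p := fun y => decide (r w y)) (l := M₂.drop Q.length)
    rw [List.length_drop] at h2
    omega
  have hS₂ : M₂.countP (fun y => r y u) = 0 := by
    rw [List.countP_eq_zero]
    simpa using hM₂
  have hchain : (M₁ ++ [x]).IsChain fun y z => ¬ (r y u ∧ r w z) := by
    apply List.isChain_of_forall_split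
    rintro N₁ y z N₂ e' ⟨hy, hz⟩
    have := hreplace N₁ y [] (z :: N₂ ++ M₂) (by
      have : M = (M₁ ++ [x]) ++ M₂ := by simp [e]
      rw [this, e']
      simp) hy (by simpa using hz)
    exact hQne (by simpa using this)
  obtain ⟨a, L, hL⟩ : ∃ a L, M₁ ++ [x] = a :: L := by cases M₁ <;> simp
  have hcount := List.countP_dropLast_add_countP_le _ _ a L (hL ▸ hchain)
  rw [← hL, List.dropLast_concat] at hcount
  have hLlen := congrArg List.length hL
  have hLB := congrArg (List.countP fun y => decide (r w y)) hL
  have hle : (if r w a then 1 else 0) ≤ 1 := by split_ifs <;> simp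
  rw [e]
  simp only [List.countP_append, List.countP_cons, List.length_append, List.length_cons,
    List.countP_nil, List.length_nil, decide_eq_true_eq] at *
  simp only [hx, if_true]
  omega

open Classical in
theorem exists_hamiltonian_cycle {W : Type*} [Fintype W] [Nonempty W] (r : W → W → Prop)
    (hirr : ∀ x, ¬ r x x) (p q : ℕ) (hqp : q ≤ p) (hpq : Fintype.card W ≤ p + q)
    (hout : ∀ v, p ≤ (Finset.univ.filter fun w => r v w).card)
    (hin : ∀ v, q ≤ (Finset.univ.filter fun w => r w v).card) :
    ∃ b M, IsCycleFrom r b M ∧ ∀ v, v ∈ M := by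
  have hcard : 0 < Fintype.card W := Fintype.card_pos
  obtain ⟨b₀, M₀, hM₀, hlen₀⟩ := exists_cycle_of_outDegree r hirr p (by omega) hout
  obtain ⟨M, ⟨b, hM⟩, hmax⟩ := List.exists_longest (fun M => ∃ b, IsCycleFrom r b M)
    (fun M h => h.choose_spec.2.1) ⟨M₀, b₀, hM₀⟩
  have hpM : p + 1 ≤ M.length := hlen₀.trans (hmax M₀ ⟨b₀, hM₀⟩)
  refine ⟨b, M, hM, ?_⟩
  by_contra! hmiss
  obtain ⟨v, hv⟩ := hmiss
  obtain ⟨Q, ⟨hQne, hQnd, hQch, hQM⟩, hQmax⟩ := List.exists_longest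
    (fun Q : List W => Q ≠ [] ∧ Q.Nodup ∧ Q.IsChain r ∧ ∀ x ∈ Q, x ∉ M)
    (fun Q h => h.2.1) ⟨[v], by simpa using hv⟩
  have hsum : M.length + Q.length ≤ Fintype.card W := by
    have : (M ++ Q).Nodup := by
      rw [List.nodup_append]
      refine ⟨hM.2.1, hQnd, ?_⟩
      rintro a ha c hc rfl
      exact hQM a hc ha
    simpa using this.length_le_card
  have hinM : ∃ u, Q.head? = some u ∧ q + 1 ≤ M.countP (fun x => r x u) + Q.length := by
    obtain ⟨u, Q', rfl⟩ := List.exists_cons_of_ne_nil hQne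
    refine ⟨u, rfl, ?_⟩
    have hsub : (Finset.univ.filter fun x => r x u) ⊆
        (M.filter fun x => r x u).toFinset ∪ Q'.toFinset := by
      intro x hx
      have hx : r x u := by simpa using hx
      by_contra hn
      simp only [Finset.mem_union, List.mem_toFinset, List.mem_filter, decide_eq_true_eq,
        not_or, not_and] at hn
      have hxM : x ∉ M := fun h => hn.1 h hx
      have hxu : x ≠ u := by rintro rfl; exact hirr _ hx
      have := hQmax (x :: u :: Q') ⟨by simp, by
        rw [List.nodup_cons]
        exact ⟨by simp [hxu, hn.2], hQnd⟩, List.isChain_cons_cons.2 ⟨hx, hQch⟩, by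
        intro y hy
        rcases List.mem_cons.1 hy with rfl | hy
        · exact hxM
        · exact hQM y hy⟩
      simp at this
    have h1 := (hin u).trans ((Finset.card_le_card hsub).trans (Finset.card_union_le _ _))
    have h2 := List.toFinset_card_le (M.filter fun x => r x u)
    have h3 := List.toFinset_card_le Q'
    rw [← List.countP_eq_length_filter] at h2
    simp only [List.length_cons]
    omega
  have houtM : ∃ w, Q.getLast? = some w ∧ p + 1 ≤ M.countP (fun y => r w y) + Q.length := by
    obtain ⟨Q', w, rfl⟩ : ∃ Q' w, Q = Q' ++ [w] :=
      ⟨_, _, (List.dropLast_append_getLast hQne).symm⟩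
    refine ⟨w, by simp, ?_⟩
    have hsub : (Finset.univ.filter fun x => r w x) ⊆
        (M.filter fun x => r w x).toFinset ∪ Q'.toFinset := by
      intro x hx
      have hx : r w x := by simpa using hx
      by_contra hn
      simp only [Finset.mem_union, List.mem_toFinset, List.mem_filter, decide_eq_true_eq,
        not_or, not_and] at hn
      have hxM : x ∉ M := fun h => hn.1 h hx
      have hxw : x ≠ w := by rintro rfl; exact hirr _ hx
      have := hQmax (Q' ++ [w] ++ [x]) ⟨by simp, by
        rw [List.nodup_append]
        refine ⟨hQnd, by simp, ?_⟩
        rintro a ha c hc rfl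
        simp only [List.mem_singleton] at hc
        subst hc
        simp [hxw, hn.2] at ha, by
        rw [List.isChain_append]
        exact ⟨hQch, by simp, by simpa using hx⟩, by
        intro y hy
        rcases List.mem_append.1 hy with hy | hy
        · exact hQM y hy
        · rw [List.mem_singleton.1 hy]
          exact hxM⟩
      simp at this
    have h1 := (hout w).trans ((Finset.card_le_card hsub).trans (Finset.card_union_le _ _))
    have h2 := List.toFinset_card_le (M.filter fun x => r w x)
    have h3 := List.toFinset_card_le Q'
    rw [← List.countP_eq_length_filter] at h2
    simp only [List.length_append, List.length_singleton]
    omega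
  obtain ⟨u, hu, huM⟩ := hinM
  obtain ⟨w, hw, hwM⟩ := houtM
  obtain ⟨c, hcM, hwc⟩ : ∃ c ∈ M, r w c := by
    have : 0 < M.countP (fun y => r w y) := by omega
    simpa using List.countP_pos_iff.1 this
  obtain ⟨x, hxM, hxu⟩ : ∃ x ∈ M, r x u := by
    have : 0 < M.countP (fun x => r x u) := by omega
    simpa using List.countP_pos_iff.1 this
  obtain ⟨M', hperm, hM'⟩ := hM.rotate hcM
  have := hM'.countP_add_countP_le (fun M'' h => by
      rw [hperm.length_eq]
      exact hmax M'' ⟨c, h⟩) hQnd hQch (fun x hx h => hQM x hx (hperm.mem_iff.1 h)) hu hw hwc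
    ⟨x, hperm.mem_iff.2 hxM, hxu⟩
  rw [hperm.countP_eq, hperm.countP_eq, hperm.length_eq] at this
  omega

open Classical in
theorem exists_dipaths_of_isChain {V : Type*} (A : V → V → Prop) (s : V) (T : Set V)
    (L pre : List V) (hpreT : ∀ v ∈ pre, v ∉ T) (hnd : (s :: (pre ++ L)).Nodup)
    (hpre : (s :: pre).IsChain A)
    (hlink : ∀ x ∈ (s :: pre).getLast?, ∀ y ∈ L.head?, A x y)
    (hL : L.IsChain fun x y => (x ∈ T ∧ A s y) ∨ (x ∉ T ∧ A x y))
    (hlast : ∀ x ∈ (pre ++ L).getLast?, x ∈ T) :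
    ∃ F : V → List V,
      (∀ t ∈ L, t ∈ T → IsDipath A (F t) s t ∧ ∀ v ∈ F t, v = s ∨ v ∈ pre ++ L) ∧
      (∀ t ∈ L, t ∈ T → ∀ t' ∈ L, t' ∈ T → t ≠ t' → ∀ v, v ∈ F t → v ∈ F t' → v = s) ∧
      (∀ v ∈ pre ++ L, ∃ t ∈ L, t ∈ T ∧ v ∈ F t) := by
  induction L generalizing pre with
  | nil =>
    have hnil : pre = [] := by
      by_contra hne
      rw [List.append_nil] at hlast
      exact hpreT _ (List.getLast_mem hne) (hlast _ (List.getLast?_eq_getLast_of_ne_nil hne))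
    subst hnil
    exact ⟨fun _ => [], by simp⟩
  | cons a L ih =>
    have hpath : (s :: (pre ++ [a])).IsChain A := by
      rw [← List.cons_append, List.isChain_append]
      exact ⟨hpre, by simp, by simpa using hlink⟩
    rw [List.isChain_cons] at hL
    by_cases ha : a ∈ T
    · obtain ⟨F, h1, h2, h3⟩ := ih [] (by simp) (by
          clear * - hnd
          simp only [List.nodup_cons, List.nodup_append, List.mem_append, List.mem_cons,
            List.nil_append] at *
          grind) (by simp) (by
          intro x hx y hy
          simp only [List.getLast?_singleton, Option.mem_some_iff] at hx
          subst hx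
          rcases hL.1 y hy with h | h
          · exact h.2
          · exact absurd ha h.1) hL.2 (by
          intro x hx
          cases L with
          | nil => simp at hx
          | cons c L =>
            apply hlast
            rw [List.nil_append] at hx
            rwa [List.getLast?_append_of_ne_nil _ (by simp), List.getLast?_cons_cons])
      have haL : a ∉ L := by
        clear * - hnd
        simp only [List.nodup_cons, List.nodup_append] at hnd
        exact hnd.2.2.1.1
      have hdisj : ∀ v, v ∈ s :: (pre ++ [a]) → v ∈ L → False := by
        clear * - hnd
        simp only [List.nodup_cons, List.nodup_append, List.mem_append, List.mem_cons] at *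
        grind
      have hne : ∀ t ∈ L, t ≠ a := fun t ht h => haL (h ▸ ht)
      refine ⟨Function.update F a (s :: (pre ++ [a])), ?_, ?_, ?_⟩
      · intro t ht htT
        rcases List.mem_cons.1 ht with rfl | ht
        · rw [Function.update_self]
          refine ⟨⟨by simp, hpath, ?_, rfl, ?_⟩, ?_⟩
          · refine hnd.sublist ?_
            simp
          · rw [← List.cons_append]
            exact List.getLast?_concat
          · intro v hv
            simp only [List.mem_cons, List.mem_append, List.not_mem_nil, or_false] at hv ⊢
            tauto
        · rw [Function.update_of_ne (hne t ht)]
          refine ⟨(h1 t ht htT).1, fun v hv => ?_⟩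
          rcases (h1 t ht htT).2 v hv with h | h
          · exact Or.inl h
          · right
            simp only [List.nil_append] at h
            simp [h]
      · intro t ht htT t' ht' htT' htt v hv hv'
        rcases List.mem_cons.1 ht with rfl | ht <;> rcases List.mem_cons.1 ht' with rfl | ht'
        · exact absurd rfl htt
        · rw [Function.update_self] at hv
          rw [Function.update_of_ne (hne t' ht')] at hv'
          rcases (h1 t' ht' htT').2 v hv' with h | h
          · exact h
          · exact (hdisj v hv h).elim
        · rw [Function.update_self] at hv'
          rw [Function.update_of_ne (hne t ‹_›)] at hv
          rcases (h1 t ‹_› htT).2 v hv with h | h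
          · exact h
          · exact (hdisj v hv' h).elim
        · rw [Function.update_of_ne (hne t ht)] at hv
          rw [Function.update_of_ne (hne t' ht')] at hv'
          exact h2 t ht htT t' ht' htT' htt v hv hv'
      · intro v hv
        by_cases hvL : v ∈ L
        · obtain ⟨t, ht, htT, hvt⟩ := h3 v hvL
          exact ⟨t, List.mem_cons_of_mem _ ht, htT, by rwa [Function.update_of_ne (hne t ht)]⟩
        · refine ⟨a, by simp, ha, ?_⟩
          rw [Function.update_self]
          simp only [List.mem_cons, List.mem_append, List.not_mem_nil, or_false] at hv ⊢
          tauto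
    · obtain ⟨F, h1, h2, h3⟩ := ih (pre ++ [a]) (by
          intro v hv
          rcases List.mem_append.1 hv with hv | hv
          · exact hpreT v hv
          · rw [List.mem_singleton.1 hv]
            exact ha) (by simpa using hnd) hpath (by
          intro x hx y hy
          rw [← List.cons_append, List.getLast?_concat] at hx
          simp only [Option.mem_some_iff] at hx
          subst hx
          rcases hL.1 y hy with h | h
          · exact absurd h.1 ha
          · exact h.2) hL.2 (by simpa using hlast)
      have hmem : ∀ t ∈ a :: L, t ∈ T → t ∈ L := by
        intro t ht htT
        rcases List.mem_cons.1 ht with rfl | ht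
        · exact absurd htT ha
        · exact ht
      refine ⟨F, fun t ht htT => ?_, fun t ht htT t' ht' htT' =>
        h2 t (hmem t ht htT) htT t' (hmem t' ht' htT') htT', fun v hv => ?_⟩
      · simpa using h1 t (hmem t ht htT) htT
      · obtain ⟨t, ht, h⟩ := h3 v (by simpa using hv)
        exact ⟨t, List.mem_cons_of_mem _ ht, h⟩

/-- Let `D` be a digraph of order `n ≥ 3k`, `k ≥ 2`. If
`δ⁰(D) ≥ ⌈(n+k)/2⌉`, then `D` is one-to-many `k`-coverable. -/
theorem one_to_many_of_min_semi_degree {V : Type*} [Fintype V]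
    (A : V → V → Prop) (hirr : Irreflexive A) (k : ℕ) (hk : 2 ≤ k)
    (hn : 3 * k ≤ Fintype.card V)
    (hdeg : ∀ v : V, (Fintype.card V + k + 1) / 2 ≤ outDeg A v ∧
      (Fintype.card V + k + 1) / 2 ≤ inDeg A v) :
    OneToManyCoverable A k := by
  classical
  intro s t ht hts
  set d := (Fintype.card V + k + 1) / 2 with hd
  have hout : ∀ v, d ≤ (Finset.univ.filter fun w => A v w).card := by
    intro v
    have := (hdeg v).1
    rwa [outDeg, Nat.card_eq_fintype_card, Fintype.card_subtype] at this
  have hin : ∀ v, d ≤ (Finset.univ.filter fun w => A w v).card := by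
    intro v
    have := (hdeg v).2
    rwa [inDeg, Nat.card_eq_fintype_card, Fintype.card_subtype] at this
  set T : Finset V := Finset.univ.image t with hT
  have hTcard : T.card = k := by
    rw [hT, Finset.card_image_of_injective _ ht, Finset.card_univ, Fintype.card_fin]
  have hsT : s ∉ T := by simpa [hT] using hts
  let t₀ : {v // v ≠ s} := ⟨t ⟨0, by omega⟩, hts _⟩
  have ht₀ : t₀.1 ∈ T := Finset.mem_image_of_mem _ (Finset.mem_univ _)
  have : Nonempty {v // v ≠ s} := ⟨t₀⟩
  -- Cutting a Hamiltonian cycle of this relation at the vertices of `T` gives the cover.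
  let r : {v // v ≠ s} → {v // v ≠ s} → Prop := fun x y =>
    x ≠ y ∧ ((x.1 ∈ T ∧ A s y.1) ∨ (x.1 ∉ T ∧ A x.1 y.1))
  have hcardW : Fintype.card {v // v ≠ s} = Fintype.card V - 1 := by
    rw [Fintype.card_subtype_compl, Fintype.card_subtype_eq]
  have hle : ∀ (P : {v // v ≠ s} → Prop) (X : Finset V),
      (∀ x ∈ X, ∃ h : x ≠ s, P ⟨x, h⟩) → X.card ≤ (Finset.univ.filter P).card := by
    intro P X hX
    rw [← Finset.card_map (Function.Embedding.subtype _)]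
    refine Finset.card_le_card fun x hx => ?_
    obtain ⟨h, hP⟩ := hX x hx
    exact Finset.mem_map.2 ⟨⟨x, h⟩, by simpa using hP, rfl⟩
  obtain ⟨b, M, hM, hall⟩ := exists_hamiltonian_cycle r (fun x h => h.1 rfl) (d - 1) (d - k)
    (by omega) (by rw [hcardW]; omega)
    (by
      intro x
      by_cases hx : x.1 ∈ T
      · refine (Nat.sub_le_sub_right (hout s) 1).trans
          (Finset.pred_card_le_card_erase.trans (hle _ (Finset.erase _ x.1) ?_))
        intro y hy
        simp only [Finset.mem_erase, Finset.mem_filter, Finset.mem_univ, true_and] at hy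
        refine ⟨fun h => hirr s (h ▸ hy.2), fun h => hy.1 ?_, Or.inl ⟨hx, hy.2⟩⟩
        rw [h]
      · refine (Nat.sub_le_sub_right (hout x.1) 1).trans
          (Finset.pred_card_le_card_erase.trans (hle _ (Finset.erase _ s) ?_))
        intro y hy
        simp only [Finset.mem_erase, Finset.mem_filter, Finset.mem_univ, true_and] at hy
        refine ⟨hy.1, fun h => hirr y ?_, Or.inr ⟨hx, hy.2⟩⟩
        have := hy.2
        rwa [h] at this)
    (by
      intro y
      have hsd := Finset.le_card_sdiff T (Finset.univ.filter fun w => A w y.1)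
      have hiny := hin y.1
      by_cases hy : A s y.1
      · obtain ⟨t', ht', hty⟩ := Finset.exists_mem_ne (by omega : 1 < T.card) y.1
        refine le_trans ?_ (hle _
          (insert t' (((Finset.univ.filter fun w => A w y.1) \ T).erase s)) ?_)
        · rw [Finset.card_insert_of_notMem (by simp [ht'])]
          have := Finset.pred_card_le_card_erase
            (s := (Finset.univ.filter fun w => A w y.1) \ T) (a := s)
          omega
        · intro x hx
          rcases Finset.mem_insert.1 hx with rfl | hx
          · exact ⟨fun h => hsT (h ▸ ht'), fun h => hty (congrArg Subtype.val h),
              Or.inl ⟨ht', hy⟩⟩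
          · simp only [Finset.mem_erase, Finset.mem_sdiff, Finset.mem_filter,
              Finset.mem_univ, true_and] at hx
            refine ⟨hx.1, fun h => hirr x ?_, Or.inr ⟨hx.2.2, hx.2.1⟩⟩
            have := hx.2.1
            rwa [← h] at this
      · refine le_trans ?_ (hle _ ((Finset.univ.filter fun w => A w y.1) \ T) ?_)
        · omega
        · intro x hx
          simp only [Finset.mem_sdiff, Finset.mem_filter, Finset.mem_univ, true_and] at hx
          refine ⟨fun h => hy (h ▸ hx.1), fun h => hirr x ?_, Or.inr ⟨hx.2, hx.1⟩⟩
          have := hx.1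
          rwa [← h] at this)
  obtain ⟨M', hperm, hhd, hnd, hch⟩ := hM.rotate (hall t₀)
  obtain ⟨L, rfl⟩ : ∃ L, M' = t₀ :: L := by
    cases M' with
    | nil => simp at hhd
    | cons a L =>
      simp only [List.head?_cons, Option.some.injEq] at hhd
      exact ⟨L, by rw [hhd]⟩
  have hmemL : ∀ v, v ≠ s → v ∈ (L ++ [t₀]).map Subtype.val := by
    intro v hv
    have := hperm.mem_iff.2 (hall ⟨v, hv⟩)
    refine List.mem_map.2 ⟨⟨v, hv⟩, ?_, rfl⟩
    simp only [List.mem_cons, List.mem_append, List.not_mem_nil, or_false] at this ⊢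
    exact this.symm
  rw [List.cons_append, List.isChain_cons] at hch
  obtain ⟨F, h1, h2, h3⟩ := exists_dipaths_of_isChain A s T ((L ++ [t₀]).map Subtype.val) []
    (by simp)
    (by
      rw [List.nil_append, List.nodup_cons]
      refine ⟨by simp [Ne.symm t₀.2], ?_⟩
      refine List.Nodup.map Subtype.val_injective ?_
      exact (List.perm_append_singleton t₀ L).nodup_iff.2 hnd)
    (by simp)
    (by
      intro x hx y hy
      simp only [List.getLast?_singleton, Option.mem_some_iff] at hx
      subst hx
      rw [List.head?_map] at hy
      obtain ⟨z, hz, rfl⟩ := Option.map_eq_some_iff.1 hy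
      rcases (hch.1 z hz).2 with h | h
      · exact h.2
      · exact absurd ht₀ h.1)
    (by
      rw [List.isChain_map]
      exact hch.2.imp fun x y h => by simpa using h.2)
    (by
      rw [List.nil_append, List.map_append, List.map_singleton, List.getLast?_concat]
      simpa using ht₀)
  have htT : ∀ i, t i ∈ (T : Set V) := fun i =>
    Finset.mem_coe.2 (Finset.mem_image_of_mem _ (Finset.mem_univ i))
  have htL : ∀ i, t i ∈ (L ++ [t₀]).map Subtype.val := fun i => hmemL _ (hts i)
  refine ⟨fun i => F (t i), fun i => (h1 _ (htL i) (htT i)).1, fun i j hij =>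
    h2 _ (htL i) (htT i) _ (htL j) (htT j) (ht.ne hij), fun v => ?_⟩
  by_cases hv : v = s
  · subst hv
    exact ⟨⟨0, by omega⟩, List.mem_of_head? (h1 _ (htL _) (htT _)).1.2.2.2.1⟩
  · obtain ⟨t', -, ht', hvt⟩ := h3 v (hmemL v hv)
    obtain ⟨i, -, rfl⟩ := Finset.mem_image.1 (Finset.mem_coe.1 ht')
    exact ⟨i, hvt⟩
end

section
/- For every integer k ≥ 2 and every integer n ≥ k + 2, there exists a digraph D on n vertices with minimum semi-degree δ⁰(D) = ⌈(n + k − 1)/2⌉ − 1 which is not one-to-many k-coverable. -/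
/-- Adjacency in the union of two cliques on `[0, k + m)` and on
`[0, k) ∪ [k + m, n)`, which overlap in `[0, k)`. -/
def twoCliques (n k m : ℕ) (u v : Fin n) : Prop :=
  u ≠ v ∧ (u.val < k ∨ v.val < k ∨ (u.val < k + m ↔ v.val < k + m))

theorem twoCliques_comm {n k m : ℕ} (u v : Fin n) :
    twoCliques n k m u v ↔ twoCliques n k m v u := by
  unfold twoCliques
  grind

theorem inDeg_twoCliques {n k m : ℕ} (v : Fin n) :
    inDeg (twoCliques n k m) v = outDeg (twoCliques n k m) v := by
  simp only [inDeg, outDeg, twoCliques_comm]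

theorem Fin.natCard_subtype_le {n : ℕ} {p : Fin n → Prop} (S : Finset ℕ)
    (h : ∀ w, p w → w.val ∈ S) : Nat.card {w // p w} ≤ S.card := by
  classical
  rw [Nat.card_eq_fintype_card, Fintype.card_subtype]
  exact Finset.card_le_card_of_injOn Fin.val (fun w hw => h w (by simpa using hw))
    Fin.val_injective.injOn

theorem Fin.le_natCard_subtype {n c : ℕ} {p : Fin n → Prop} (S : Finset ℕ)
    (h : ∀ w, ¬ p w → w.val ∈ S) (hc : c + S.card ≤ n) : c ≤ Nat.card {w // p w} := by
  classical
  have hS := Fin.natCard_subtype_le S h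
  have hn := Fintype.card_subtype_compl p
  have hle := Fintype.card_subtype_le p
  rw [Nat.card_eq_fintype_card] at hS ⊢
  rw [Fintype.card_fin] at hn hle
  omega

theorem le_outDeg_twoCliques {n k m : ℕ} (hn : k + 2 * m ≤ n) (v : Fin n) :
    k + m - 1 ≤ outDeg (twoCliques n k m) v := by
  have hv := v.isLt
  by_cases hA : v.val < k + m
  · refine Fin.le_natCard_subtype (insert v.val (Finset.Ico (k + m) n)) (fun w hw => ?_) ?_
    · have := w.isLt
      simp only [twoCliques, Fin.ext_iff, ne_eq, Finset.mem_insert, Finset.mem_Ico] at hw ⊢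
      omega
    · have := Finset.card_insert_le v.val (Finset.Ico (k + m) n)
      rw [Nat.card_Ico] at this
      omega
  · refine Fin.le_natCard_subtype (insert v.val (Finset.Ico k (k + m))) (fun w hw => ?_) ?_
    · simp only [twoCliques, Fin.ext_iff, ne_eq, Finset.mem_insert, Finset.mem_Ico] at hw ⊢
      omega
    · have := Finset.card_insert_le v.val (Finset.Ico k (k + m))
      rw [Nat.card_Ico] at this
      omega

theorem outDeg_twoCliques_le {n k m : ℕ} (v : Fin n) (hk : k ≤ v.val) (hv : v.val < k + m) :
    outDeg (twoCliques n k m) v ≤ k + m - 1 := by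
  have h : outDeg (twoCliques n k m) v ≤ ((Finset.range (k + m)).erase v.val).card := by
    refine Fin.natCard_subtype_le _ fun w hw => ?_
    simp only [twoCliques, Fin.ext_iff, ne_eq, Finset.mem_erase, Finset.mem_range] at hw ⊢
    omega
  rwa [Finset.card_erase_of_mem (Finset.mem_range.2 hv), Finset.card_range] at h

/-- A path starting in the first clique outside the overlap, and meeting the overlap only in its
last vertex, stays in the first clique. -/
theorem lt_of_mem_isChain_twoCliques {n k m : ℕ} {t : Fin n} (l : List (Fin n)) :
    ∀ a : Fin n, k ≤ a.val → a.val < k + m → (a :: l).IsChain (twoCliques n k m) →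
      (a :: l).Nodup → (a :: l).getLast? = some t →
      (∀ x ∈ a :: l, x.val < k → x = t) → ∀ x ∈ a :: l, x.val < k + m := by
  induction l with
  | nil =>
    intro a _ ham _ _ _ _ x hx
    rwa [List.mem_singleton.1 hx]
  | cons b l ih =>
    intro a hka ham hc hnd hlast hT x hx
    rw [List.isChain_cons_cons] at hc
    rw [List.getLast?_cons_cons] at hlast
    rcases List.mem_cons.1 hx with rfl | hx
    · exact ham
    by_cases hb : b.val < k
    · obtain rfl := hT b (by simp) hb
      cases l with
      | nil =>
        obtain rfl := List.mem_singleton.1 hx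
        omega
      | cons c l =>
        rw [List.getLast?_cons_cons] at hlast
        exact absurd (List.mem_of_getLast? hlast) (List.nodup_cons.1 hnd.of_cons).1
    · have hab := hc.1.2
      exact ih b (by omega) (by omega) hc.2 hnd.of_cons hlast
        (fun y hy => hT y (List.mem_cons_of_mem a hy)) x hx

theorem not_oneToManyCoverable_twoCliques {n k m : ℕ} (hm : 1 ≤ m) (hn : k + m < n) :
    ¬ OneToManyCoverable (twoCliques n k m) k := by
  intro h
  obtain ⟨P, hP, hdisj, hcov⟩ := h ⟨k, by omega⟩ (fun i => ⟨i.val, by omega⟩)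
    (fun i j hij => by simpa [Fin.ext_iff] using hij) (fun i => by simp [Fin.ext_iff, i.isLt.ne])
  obtain ⟨i, hi⟩ := hcov ⟨k + m, hn⟩
  obtain ⟨-, hchain, hnd, hhead, hlast⟩ := hP i
  have hT : ∀ x ∈ P i, x.val < k → x = ⟨i.val, by omega⟩ := by
    intro x hx hxk
    by_contra hne
    have hx' : x ∈ P ⟨x.val, hxk⟩ := List.mem_of_getLast? (hP ⟨x.val, hxk⟩).2.2.2.2
    have := hdisj i ⟨x.val, hxk⟩ (fun h => hne (by simp [h])) x hx hx'
    simp [this] at hxk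
  obtain ⟨l, hl⟩ := List.head?_eq_some_iff.1 hhead
  rw [hl] at hchain hnd hlast hT hi
  have := lt_of_mem_isChain_twoCliques (k := k) (m := m) l ⟨k, by omega⟩ le_rfl
    (Nat.lt_add_of_pos_right hm) hchain hnd hlast hT _ hi
  simp at this

/-- For every `k ≥ 2` and `n ≥ k + 2`, there is a digraph on `n` vertices
with minimum semi-degree exactly `⌈(n+k-1)/2⌉ - 1` which is not one-to-many
`k`-coverable. -/
theorem exists_not_one_to_many_coverable (k n : ℕ) (hk : 2 ≤ k)
    (hn : k + 2 ≤ n) :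
    ∃ A : Fin n → Fin n → Prop, Irreflexive A ∧
      (∀ v, (n + k) / 2 - 1 ≤ outDeg A v ∧ (n + k) / 2 - 1 ≤ inDeg A v) ∧
      (∃ v, outDeg A v = (n + k) / 2 - 1 ∨ inDeg A v = (n + k) / 2 - 1) ∧
      ¬ OneToManyCoverable A k := by
  obtain ⟨m, hm⟩ : ∃ m, m = (n - k) / 2 := ⟨_, rfl⟩
  have hd : (n + k) / 2 - 1 = k + m - 1 := by omega
  have hlow := le_outDeg_twoCliques (n := n) (k := k) (m := m) (by omega)
  rw [hd]
  refine ⟨twoCliques n k m, fun v hv => hv.1 rfl, fun v => ⟨hlow v, ?_⟩,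
    ⟨⟨k, by omega⟩, Or.inl (le_antisymm ?_ (hlow _))⟩,
    not_oneToManyCoverable_twoCliques (by omega) (by omega)⟩
  · rw [inDeg_twoCliques]
    exact hlow v
  · exact outDeg_twoCliques_le _ le_rfl (by simp only; omega)
end

section
/- For every integer k ≥ 2 and every integer n ≥ k + 1, there exists a digraph D on n vertices with minimum semi-degree δ⁰(D) = ⌈(n + k)/2⌉ − 2 which is not one-to-one k-coverable. -/
/-- The digraph with arc relation `A` is one-to-one `k`-coverable: for every
pair of distinct vertices `s` and `t` there are `k` directed paths from `s`
to `t` covering all vertices, any two of them meeting exactly in `{s, t}`. -/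
def OneToOneCoverable {V : Type*} (A : V → V → Prop) (k : ℕ) : Prop :=
  ∀ s t : V, s ≠ t →
    ∃ P : Fin k → List V,
      (∀ i, IsDipath A (P i) s t) ∧
      (∀ i j, i ≠ j → ∀ v, v ∈ P i → v ∈ P j → v = s ∨ v = t) ∧
      (∀ v : V, ∃ i, v ∈ P i)

/-- A property that is preserved along arcs whose head avoids `q` propagates along a chain
avoiding `q`. -/
theorem List.IsChain.forall_mem_of_step {V : Type*} {A : V → V → Prop} {p q : V → Prop}
    (step : ∀ x y, A x y → p x → ¬ q y → p y) :
    ∀ (l : List V) (s : V), (s :: l).IsChain A → p s → (∀ x ∈ l, ¬ q x) → ∀ x ∈ s :: l, p x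
  | [], s, _, hs, _ => by simpa using hs
  | y :: l, s, hc, hs, hq => by
    rw [List.isChain_cons_cons] at hc
    have hy : p y := step s y hc.1 hs (hq y (by simp))
    have ih := List.IsChain.forall_mem_of_step step l y hc.2 hy
      (fun x hx => hq x (List.mem_cons_of_mem _ hx))
    intro x hx
    rcases List.mem_cons.1 hx with rfl | hx
    · exact hs
    · exact ih x hx

/-- If every arc leaving `p` ends in `p` or `q`, then a directed path from inside `p` to
outside `p` meets `q`. -/
theorem IsDipath.exists_mem_separator {V : Type*} {A : V → V → Prop} {p q : V → Prop}
    (step : ∀ x y, A x y → p x → ¬ q y → p y) {l : List V} {s t : V}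
    (h : IsDipath A l s t) (hs : p s) (ht : ¬ p t) : ∃ x ∈ l, q x := by
  obtain ⟨-, hc, -, hhead, hlast⟩ := h
  by_contra! hq
  obtain ⟨m, rfl⟩ := List.head?_eq_some_iff.1 hhead
  exact ht (List.IsChain.forall_mem_of_step step m s hc hs
    (fun x hx => hq x (List.mem_cons_of_mem _ hx)) t (List.mem_of_getLast? hlast))

/-- The digraph on `Fin n` with all arcs except those from the last `a` vertices to the
first `b` vertices. -/
def separatedDigraph (n a b : ℕ) (v w : Fin n) : Prop :=
  v ≠ w ∧ ¬ (n - a ≤ v.1 ∧ w.1 < b)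

theorem outDeg_separatedDigraph_ge {n a b : ℕ} (hb : b < n) (v : Fin n) :
    n - b - 1 ≤ outDeg (separatedDigraph n a b) v := by
  classical
  rw [outDeg, Nat.card_eq_fintype_card, Fintype.card_subtype]
  calc n - b - 1 = (Finset.Ici (⟨b, hb⟩ : Fin n)).card - 1 := by rw [Fin.card_Ici]
    _ ≤ ((Finset.Ici (⟨b, hb⟩ : Fin n)).erase v).card := Finset.pred_card_le_card_erase
    _ ≤ _ := Finset.card_le_card fun w hw => by
      simp only [Finset.mem_erase, Finset.mem_Ici, Fin.le_def] at hw
      exact Finset.mem_filter.2 ⟨Finset.mem_univ w, hw.1.symm, by omega⟩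

theorem inDeg_separatedDigraph_ge {n a b : ℕ} (ha : n - a < n) (v : Fin n) :
    n - a - 1 ≤ inDeg (separatedDigraph n a b) v := by
  classical
  rw [inDeg, Nat.card_eq_fintype_card, Fintype.card_subtype]
  calc n - a - 1 = (Finset.Iio (⟨n - a, ha⟩ : Fin n)).card - 1 := by rw [Fin.card_Iio]
    _ ≤ ((Finset.Iio (⟨n - a, ha⟩ : Fin n)).erase v).card := Finset.pred_card_le_card_erase
    _ ≤ _ := Finset.card_le_card fun w hw => by
      simp only [Finset.mem_erase, Finset.mem_Iio, Fin.lt_def] at hw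
      exact Finset.mem_filter.2 ⟨Finset.mem_univ w, hw.1, by omega⟩

theorem outDeg_separatedDigraph_eq {n a b : ℕ} (hb : b < n) {v : Fin n} (hv : n - a ≤ v.1)
    (hbv : b ≤ v.1) : outDeg (separatedDigraph n a b) v = n - b - 1 := by
  classical
  rw [outDeg, Nat.card_eq_fintype_card, Fintype.card_subtype]
  have h : Finset.univ.filter (fun w => separatedDigraph n a b v w) =
      (Finset.Ici (⟨b, hb⟩ : Fin n)).erase v := by
    ext w
    simp only [Finset.mem_erase, Finset.mem_Ici, Fin.le_def, Finset.mem_filter,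
      Finset.mem_univ, true_and, separatedDigraph, ne_eq, eq_comm (a := v)]
    exact and_congr_right fun _ => by omega
  rw [h, Finset.card_erase_of_mem (by simpa [Fin.le_def] using hbv), Fin.card_Ici]

theorem not_oneToOneCoverable_separatedDigraph {n a b k : ℕ} (ha : 1 ≤ a) (hb : 1 ≤ b)
    (hbn : b < n) (hban : b ≤ n - a) (hk : n - a - b < k) :
    ¬ OneToOneCoverable (separatedDigraph n a b) k := by
  intro hcov
  obtain ⟨P, hP, hdisj, -⟩ := hcov ⟨n - 1, by omega⟩ ⟨0, by omega⟩
    (by simp only [ne_eq, Fin.mk.injEq]; omega)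
  have hmeet : ∀ i, ∃ x ∈ P i, b ≤ x.1 ∧ x.1 < n - a := fun i =>
    (hP i).exists_mem_separator (p := fun x => n - a ≤ x.1)
      (fun x y hxy hx hy => by
        have := hxy.2
        omega)
      (by simp only; omega) (by simp only; omega)
  choose f hfP hf using hmeet
  have hinj : Function.Injective f := by
    intro i j hij
    by_contra hne
    have hfi := hf i
    rcases hdisj i j hne (f i) (hfP i) (hij ▸ hfP j) with h | h <;>
    · rw [h] at hfi
      simp only at hfi
      omega
  have hcard : (Finset.univ : Finset (Fin k)).card ≤ (Finset.Ico b (n - a)).card :=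
    Finset.card_le_card_of_injOn (fun i => (f i).1)
      (fun i _ => by simpa using hf i)
      (fun i _ j _ h => hinj (Fin.ext h))
  rw [Finset.card_univ, Fintype.card_fin, Nat.card_Ico] at hcard
  omega

/-- For every `k ≥ 2` and `n ≥ k + 1`, there is a digraph on `n` vertices
with minimum semi-degree exactly `⌈(n+k)/2⌉ - 2` which is not one-to-one
`k`-coverable. -/
theorem exists_not_one_to_one_coverable (k n : ℕ) (hk : 2 ≤ k)
    (hn : k + 1 ≤ n) :
    ∃ A : Fin n → Fin n → Prop, Irreflexive A ∧
      (∀ v, (n + k + 1) / 2 - 2 ≤ outDeg A v ∧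
        (n + k + 1) / 2 - 2 ≤ inDeg A v) ∧
      (∃ v, outDeg A v = (n + k + 1) / 2 - 2 ∨
        inDeg A v = (n + k + 1) / 2 - 2) ∧
      ¬ OneToOneCoverable A k := by
  refine ⟨separatedDigraph n ((n - k + 1) / 2) ((n - k + 2) / 2), fun v h => h.1 rfl,
    fun v => ⟨?_, ?_⟩, ⟨⟨n - 1, by omega⟩, Or.inl ?_⟩, ?_⟩
  · exact le_trans (by omega) (outDeg_separatedDigraph_ge (by omega) v)
  · exact le_trans (by omega) (inDeg_separatedDigraph_ge (by omega) v)
  · rw [outDeg_separatedDigraph_eq (by omega) (by simp only; omega) (by simp only; omega)]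
    omega
  · exact not_oneToOneCoverable_separatedDigraph (by omega) (by omega) (by omega) (by omega)
      (by omega)
end
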